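/- arXiv:2407.20362 — 6 statements merged into one kernel-verified Lean document; each statement's English description precedes it below -/
import Mathlib

section
/- Let P(t) be a symmetric n×n univariate polynomial matrix of degree at most d, where d is odd. Then P(t) is positive semidefinite for every t ∈ [-1,1] if and only if there exist sos-matrices X₁(t) and X₂(t) of degree at most d-1 such that P(t) = (t+1)·X₁(t) + (1-t)·X₂(t) for all t ∈ ℝ. -/
open Matrix Polynomial

/-- A univariate polynomial matrix `Y(t)` is an sos-matrix if `Y(t) = A(t)ᵀ A(t)` for some
(not necessarily square) univariate polynomial matrix `A(t)`. -/
def IsSosMatrix {n : ℕ} (Y : Matrix (Fin n) (Fin n) (Polynomial ℝ)) : Prop :=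
  ∃ (r : ℕ) (A : Matrix (Fin r) (Fin n) (Polynomial ℝ)), Y = Aᵀ * A

theorem scalar_sos (m : ℕ) : ∀ q : ℝ[X], q.natDegree = m → (∀ t, 0 ≤ q.eval t) →
    ∃ f g : ℝ[X], q = f ^ 2 + g ^ 2 := by
  induction m using Nat.strong_induction_on with
  | _ m ih =>
  intro q hm hq
  by_cases h0 : m = 0
  · obtain ⟨c, rfl⟩ := Polynomial.natDegree_eq_zero.mp (hm.trans h0)
    refine ⟨C (Real.sqrt c), 0, ?_⟩
    have hc : 0 ≤ c := by simpa using hq 0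
    rw [← C_pow, Real.sq_sqrt hc]; simp
  have hdeg : q.degree ≠ 0 := by
    intro h
    exact h0 (hm ▸ natDegree_eq_of_degree_eq_some h)
  obtain ⟨z, hz⟩ := IsAlgClosed.exists_aeval_eq_zero ℂ q hdeg
  have hqne : q ≠ 0 := by rintro rfl; simp at hm; omega
  by_cases him : z.im = 0
  · obtain ⟨a, rfl⟩ : ∃ a : ℝ, z = a := ⟨z.re, by apply Complex.ext <;> simp [him]⟩
    have hroot : q.eval a = 0 := by
      have : aeval (algebraMap ℝ ℂ a) q = 0 := hz
      rw [aeval_algebraMap_apply] at this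
      simpa using this
    obtain ⟨q1, hq1⟩ := dvd_iff_isRoot.mpr hroot
    have hcl : ∀ p : ℝ[X], (∀ t, a < t → 0 ≤ p.eval t) → 0 ≤ p.eval a := by
      intro p hp
      have hc : Filter.Tendsto (fun t => p.eval t) (nhdsWithin a (Set.Ioi a)) (nhds (p.eval a)) :=
        p.continuous.continuousWithinAt
      exact ge_of_tendsto hc (by filter_upwards [self_mem_nhdsWithin] with t ht using hp t ht)
    have hcl' : ∀ p : ℝ[X], (∀ t, t < a → p.eval t ≤ 0) → p.eval a ≤ 0 := by
      intro p hp
      have hc : Filter.Tendsto (fun t => p.eval t) (nhdsWithin a (Set.Iio a)) (nhds (p.eval a)) :=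
        p.continuous.continuousWithinAt
      exact le_of_tendsto hc (by filter_upwards [self_mem_nhdsWithin] with t ht using hp t ht)
    have hev : ∀ t, 0 ≤ (t - a) * q1.eval t := by
      intro t; have := hq t; rw [hq1] at this; simpa using this
    have h1 : q1.eval a = 0 := by
      apply le_antisymm
      · apply hcl'
        intro t ht
        have := hev t
        nlinarith
      · apply hcl
        intro t ht
        have := hev t
        exact nonneg_of_mul_nonneg_right this (by linarith)
    obtain ⟨q2, hq2⟩ := dvd_iff_isRoot.mpr h1
    have hne : ∀ t, t ≠ a → 0 ≤ q2.eval t := by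
      intro t ht
      have := hev t
      rw [hq2] at this
      simp only [eval_mul, eval_sub, eval_X, eval_C] at this
      rw [← mul_assoc] at this
      exact nonneg_of_mul_nonneg_right this (mul_self_pos.mpr (sub_ne_zero.mpr ht))
    have h2 : ∀ t, 0 ≤ q2.eval t := by
      intro t
      by_cases ht : t = a
      · subst ht
        exact hcl _ fun s hs => hne s hs.ne'
      · exact hne t ht
    have hq2ne : q2 ≠ 0 := by rintro rfl; simp [hq2] at hq1; exact hqne hq1
    have hd : q2.natDegree < m := by
      rw [← hm, hq1, hq2, natDegree_mul (X_sub_C_ne_zero a) (mul_ne_zero (X_sub_C_ne_zero a) hq2ne),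
        natDegree_mul (X_sub_C_ne_zero a) hq2ne, natDegree_X_sub_C]
      omega
    obtain ⟨f, g, hfg⟩ := ih _ hd q2 rfl h2
    refine ⟨(X - C a) * f, (X - C a) * g, ?_⟩
    rw [hq1, hq2, hfg]; ring
  · obtain ⟨q2, hq2⟩ := q.quadratic_dvd_of_aeval_eq_zero_im_ne_zero hz him
    have hp : (X ^ 2 - C (2 * z.re) * X + C (‖z‖ ^ 2) : ℝ[X]) = (X - C z.re) ^ 2 + (C z.im) ^ 2 := by
      rw [Complex.sq_norm, Complex.normSq_apply]
      simp only [C_mul, C_add]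
      have : (C 2 : ℝ[X]) = 2 := rfl
      rw [this]; ring
    rw [hp] at hq2
    have h2 : ∀ t, 0 ≤ q2.eval t := by
      intro t
      have := hq t
      rw [hq2] at this
      simp only [eval_mul, eval_add, eval_pow, eval_sub, eval_X, eval_C] at this
      exact nonneg_of_mul_nonneg_right this (by positivity)
    have hq2ne : q2 ≠ 0 := by rintro rfl; simp at hq2; exact hqne hq2
    have hpd : ((X - C z.re) ^ 2 + (C z.im) ^ 2 : ℝ[X]).natDegree = 2 := by
      rw [← C_pow]; compute_degree!
    have hd : q2.natDegree < m := by
      rw [← hm, hq2, natDegree_mul (by intro h; simp [h] at hpd) hq2ne, hpd]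
      omega
    obtain ⟨f, g, hfg⟩ := ih _ hd q2 rfl h2
    refine ⟨(X - C z.re) * f + C z.im * g, (X - C z.re) * g - C z.im * f, ?_⟩
    rw [hq2, hfg]; ring

theorem exists_proj {r n : ℕ} (M N : Matrix (Fin r) (Fin n) ℂ) (h : Nᴴ * M = 0) :
    ∃ p : Matrix (Fin r) (Fin r) ℂ, pᴴ = p ∧ p * p = p ∧ p * M = M ∧ p * N = 0 := by
  let K : Submodule ℂ (EuclideanSpace ℂ (Fin r)) :=
    Submodule.span ℂ (Set.range fun j => WithLp.toLp 2 (fun i => M i j))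
  let e := Matrix.toEuclideanCLM (n := Fin r) (𝕜 := ℂ)
  have hK : IsStarProjection K.starProjection := isStarProjection_starProjection
  have hcol : ∀ v : Fin r → ℂ, (e.symm K.starProjection) *ᵥ v
      = WithLp.ofLp (K.starProjection (WithLp.toLp 2 v)) := by
    intro v
    have := Matrix.toEuclideanCLM_toLp (e.symm K.starProjection) v
    have h2 : e (e.symm K.starProjection) = K.starProjection := e.apply_symm_apply _
    change e (e.symm K.starProjection) _ = _ at this
    rw [h2] at this
    rw [this]
  refine ⟨e.symm K.starProjection, ?_, ?_, ?_, ?_⟩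
  · have h3 : e.symm (star K.starProjection) = star (e.symm K.starProjection) :=
      e.symm.map_star' _
    rw [← Matrix.star_eq_conjTranspose, ← h3, hK.isSelfAdjoint.star_eq]
  · rw [← map_mul, hK.isIdempotentElem.eq]
  · ext i j
    have h1 := hcol (fun i => M i j)
    have h2 : K.starProjection (WithLp.toLp 2 (fun i => M i j)) = WithLp.toLp 2 (fun i => M i j) :=
      Submodule.starProjection_eq_self_iff.mpr (Submodule.subset_span ⟨j, rfl⟩)
    rw [h2] at h1
    exact congrFun h1 i
  · ext i j
    have h1 := hcol (fun i => N i j)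
    have h2 : K.starProjection (WithLp.toLp 2 (fun i => N i j)) = 0 := by
      rw [Submodule.starProjection_apply_eq_zero_iff]
      rw [Submodule.mem_orthogonal']
      intro u hu
      induction hu using Submodule.span_induction with
      | mem x hx =>
        obtain ⟨k, rfl⟩ := hx
        have := congrFun (congrFun h j) k
        simp only [Matrix.mul_apply, Matrix.conjTranspose_apply, Matrix.zero_apply] at this
        rw [PiLp.inner_apply, ← this]
        refine Finset.sum_congr rfl fun i _ => ?_
        simp [mul_comm]
      | zero => simp
      | add x y _ _ hx hy => rw [inner_add_right, hx, hy, add_zero]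
      | smul a x _ hx => rw [inner_smul_right, hx, mul_zero]
    rw [h2] at h1
    exact congrFun h1 i

theorem sos_of_fintype {n : ℕ} {ι : Type} [Fintype ι] (A : Matrix ι (Fin n) ℝ[X]) :
    IsSosMatrix (Aᵀ * A) := by
  let e := Fintype.equivFin ι
  refine ⟨Fintype.card ι, A.submatrix e.symm id, ?_⟩
  rw [Matrix.transpose_submatrix, Matrix.submatrix_mul_equiv]
  simp

theorem sos_add {n : ℕ} {Y Z : Matrix (Fin n) (Fin n) ℝ[X]} (hY : IsSosMatrix Y)
    (hZ : IsSosMatrix Z) : IsSosMatrix (Y + Z) := by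
  obtain ⟨r, A, rfl⟩ := hY
  obtain ⟨s, B, rfl⟩ := hZ
  have := sos_of_fintype (Matrix.fromRows A B)
  rwa [Matrix.transpose_fromRows, Matrix.fromCols_mul_fromRows] at this

theorem sos_smul_sq {n : ℕ} {Y : Matrix (Fin n) (Fin n) ℝ[X]} (hY : IsSosMatrix Y)
    (f : ℝ[X]) : IsSosMatrix ((f ^ 2) • Y) := by
  obtain ⟨r, A, rfl⟩ := hY
  refine ⟨r, f • A, ?_⟩
  rw [Matrix.transpose_smul, Matrix.smul_mul, Matrix.mul_smul, smul_smul, sq]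

theorem sos_vec {n : ℕ} (v : Fin n → ℝ[X]) : IsSosMatrix (Matrix.vecMulVec v v) := by
  refine ⟨1, Matrix.of fun _ => v, ?_⟩
  ext i j
  simp [Matrix.vecMulVec_apply, Matrix.mul_apply]

theorem schur_psd {n : ℕ} (Q : Matrix (Fin n) (Fin n) ℝ) (hQ : Q.PosSemidef) (a : Fin n) :
    ((Q a a) ^ 2 • Q - Q a a • Matrix.vecMulVec (Q a) (Q a)).PosSemidef := by
  have h := hQ.conjTranspose_mul_mul_same
    (Q a a • (1 : Matrix (Fin n) (Fin n) ℝ) - Matrix.vecMulVec (Pi.single a 1) (Q a))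
  convert h using 1
  have hs : ∀ i j, Q i j = Q j i := fun i j => by
    have := hQ.isHermitian.apply j i
    simpa using this
  ext i j
  simp [Matrix.sub_mul, Matrix.mul_sub, Matrix.vecMulVec_mul, Matrix.mul_vecMulVec,
    Matrix.vecMulVec_apply, hs i a]
  ring

theorem psd_row_zero {n : ℕ} (Q : Matrix (Fin n) (Fin n) ℝ) (hQ : Q.PosSemidef) (a : Fin n)
    (h : Q a a = 0) (j : Fin n) : Q a j = 0 := by
  have hs : Q j a = Q a j := by
    have := hQ.isHermitian.apply j a
    simpa using this.symm
  by_cases hj : j = a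
  · rw [hj, h]
  have key : ∀ c : ℝ, 0 ≤ 2 * c * Q a j + Q j j := by
    intro c
    have := hQ.dotProduct_mulVec_nonneg (Pi.single a c + Pi.single j 1)
    simp [Matrix.mulVec_add, Matrix.mulVec_single, add_dotProduct, dotProduct_add, h, hs] at this
    linarith
  by_contra hne
  have := key (-(Q j j + 1) / (2 * Q a j))
  have h2 : 2 * (-(Q j j + 1) / (2 * Q a j)) * Q a j = -(Q j j + 1) := by field_simp
  linarith

theorem exists_denom {n : ℕ} (s : Finset (Fin n)) : ∀ Q : Matrix (Fin n) (Fin n) ℝ[X],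
    (∀ t, (Q.map (Polynomial.eval t)).PosSemidef) → (∀ i, i ∉ s → ∀ j, Q i j = 0) →
    ∃ h : ℝ[X], h ≠ 0 ∧ IsSosMatrix ((h ^ 2) • Q) := by
  induction s using Finset.induction_on with
  | empty =>
    intro Q _ h
    have : Q = 0 := by ext1 i j; exact h i (by simp) j
    exact ⟨1, one_ne_zero, 0, 0, by simp [this]⟩
  | insert a s ha ih =>
    intro Q hQ hz
    have hsym : ∀ i j, Q i j = Q j i := fun i j => by
      apply Polynomial.funext
      intro t
      have := (hQ t).isHermitian.apply j i
      simpa using this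
    by_cases h0 : Q a a = 0
    · apply ih Q hQ
      intro i hi j
      by_cases hia : i = a
      · subst hia
        apply Polynomial.funext
        intro t
        have := psd_row_zero _ (hQ t) i (by simp [h0]) j
        simpa using this
      · exact hz i (by simp [hia, hi]) j
    · obtain ⟨h, hne, hsos⟩ := ih ((Q a a) ^ 2 • Q - Q a a • Matrix.vecMulVec (Q a) (Q a)) (by
        intro t
        convert schur_psd _ (hQ t) a using 1
        ext i j
        simp [Matrix.vecMulVec_apply]) (by
        intro i hi j
        by_cases hia : i = a
        · subst hia
          simp [Matrix.vecMulVec_apply]; ring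
        · have h1 := hz i (by simp [hia, hi])
          simp [Matrix.vecMulVec_apply, h1, hsym a i])
      obtain ⟨f, g, hfg⟩ := scalar_sos _ (Q a a) rfl (fun t => by
        simpa using (hQ t).diag_nonneg (i := a))
      refine ⟨h * Q a a, mul_ne_zero hne h0, ?_⟩
      have := sos_add hsos (sos_add (sos_smul_sq (sos_vec (Q a)) (h * f))
        (sos_smul_sq (sos_vec (Q a)) (h * g)))
      convert this using 1
      rw [← add_smul, show (h * f) ^ 2 + (h * g) ^ 2 = h ^ 2 * Q a a by rw [hfg]; ring,
        smul_sub, smul_smul, smul_smul, sub_add_cancel, mul_pow]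
/-- coefficientwise complex conjugation of polynomials -/
noncomputable def cj : ℂ[X] →+* ℂ[X] := Polynomial.mapRingHom (starRingEnd ℂ)

theorem cj_X : cj X = X := by simp [cj]

theorem cj_C (z : ℂ) : cj (C z) = C (star z) := by simp [cj]

theorem cj_eval (p : ℂ[X]) (z : ℂ) : (cj p).eval z = star (p.eval (star z)) := by
  have := Polynomial.eval_map_apply (p := p) (starRingEnd ℂ) (star z)
  simpa [cj] using this

/-- conjugate transpose of a complex polynomial matrix -/
noncomputable def ctr {r n : ℕ} (A : Matrix (Fin r) (Fin n) ℂ[X]) : Matrix (Fin n) (Fin r) ℂ[X] :=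
  (A.map cj)ᵀ

theorem ctr_add {r n : ℕ} (A B : Matrix (Fin r) (Fin n) ℂ[X]) : ctr (A + B) = ctr A + ctr B := by
  ext1 i j; simp [ctr]

theorem ctr_smul {r n : ℕ} (f : ℂ[X]) (A : Matrix (Fin r) (Fin n) ℂ[X]) :
    ctr (f • A) = cj f • ctr A := by
  ext1 i j; simp [ctr]

theorem ctr_mul {r m n : ℕ} (A : Matrix (Fin r) (Fin m) ℂ[X]) (B : Matrix (Fin m) (Fin n) ℂ[X]) :
    ctr (A * B) = ctr B * ctr A := by
  simp [ctr, Matrix.map_mul, Matrix.transpose_mul]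

theorem smul_cancel {m n : ℕ} {f : ℂ[X]} (hf : f ≠ 0) {A B : Matrix (Fin m) (Fin n) ℂ[X]}
    (h : f • A = f • B) : A = B := by
  ext1 i j
  have := congrFun (congrFun h i) j
  simp only [Matrix.smul_apply, smul_eq_mul] at this
  exact mul_left_cancel₀ hf this

theorem exists_div {m n : ℕ} (A : Matrix (Fin m) (Fin n) ℂ[X]) (z : ℂ)
    (h : A.map (Polynomial.eval z) = 0) : ∃ B, A = (X - C z) • B := by
  have : ∀ i j, ∃ b, A i j = (X - C z) * b := fun i j =>
    dvd_iff_isRoot.mpr (congrFun (congrFun h i) j)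
  choose B hB using this
  exact ⟨Matrix.of B, by ext1 i j; simp [hB]⟩

theorem map_eval_mul {l m n : ℕ} (A : Matrix (Fin l) (Fin m) ℂ[X])
    (B : Matrix (Fin m) (Fin n) ℂ[X]) (z : ℂ) :
    (A * B).map (Polynomial.eval z) = A.map (Polynomial.eval z) * B.map (Polynomial.eval z) :=
  Matrix.map_mul (f := Polynomial.evalRingHom z)

theorem remove_denom {n r : ℕ} (Q : Matrix (Fin n) (Fin n) ℂ[X]) (m : ℕ) :
    ∀ (h : ℂ[X]) (A : Matrix (Fin r) (Fin n) ℂ[X]), h.natDegree = m → h ≠ 0 →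
    (cj h * h) • Q = ctr A * A → ∃ A' : Matrix (Fin r) (Fin n) ℂ[X], Q = ctr A' * A' := by
  induction m with
  | zero =>
    intro h A hm h0 hQ
    obtain ⟨c, rfl⟩ := Polynomial.natDegree_eq_zero.mp hm
    have hc : c ≠ 0 := by rintro rfl; simp at h0
    refine ⟨C c⁻¹ • A, ?_⟩
    rw [ctr_smul, Matrix.smul_mul, Matrix.mul_smul, ← hQ, smul_smul, smul_smul, cj_C, cj_C,
      ← C_mul, ← C_mul, ← C_mul]
    have : star c ≠ 0 := by simpa using hc
    have h1 : star c⁻¹ * (c⁻¹ * (star c * c)) = 1 := by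
      rw [star_inv₀]; field_simp
    simp only [mul_assoc] at *
    rw [h1]; simp
  | succ m ih =>
    intro h A hm h0 hQ
    obtain ⟨z, hz⟩ := IsAlgClosed.exists_root h (by
      intro hd
      have := natDegree_eq_of_degree_eq_some (n := 0) hd
      omega)
    obtain ⟨h', rfl⟩ := dvd_iff_isRoot.mpr hz
    have h'0 : h' ≠ 0 := right_ne_zero_of_mul h0
    have hm' : h'.natDegree = m := by
      rw [natDegree_mul (X_sub_C_ne_zero z) h'0, natDegree_X_sub_C] at hm; omega
    have horth : (A.map (Polynomial.eval (star z)))ᴴ * A.map (Polynomial.eval z) = 0 := by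
      have h1 := congrArg (fun M => M.map (Polynomial.eval z)) hQ
      simp only [map_eval_mul] at h1
      have h2 : (ctr A).map (Polynomial.eval z) = (A.map (Polynomial.eval (star z)))ᴴ := by
        ext1 i j
        simp only [ctr, Matrix.map_apply, Matrix.transpose_apply, Matrix.conjTranspose_apply]
        exact cj_eval _ _
      rw [← h2, ← h1]
      ext1 i j
      simp
    obtain ⟨p, hp1, hp2, hp3, hp4⟩ := exists_proj _ _ horth
    set R : Matrix (Fin r) (Fin r) ℂ[X] := p.map C with hR
    have hRe : ∀ w, R.map (Polynomial.eval w) = p := by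
      intro w; ext1 i j; simp [hR]
    have hRR : R * R = R := by
      rw [hR, ← Matrix.map_mul, hp2]
    have hRc : ctr R = R := by
      ext1 i j
      have := congrFun (congrFun hp1 i) j
      simp only [Matrix.conjTranspose_apply] at this
      simp only [ctr, hR, Matrix.transpose_apply, Matrix.map_apply, cj_C, this]
    obtain ⟨G, hG⟩ := exists_div (R * A) (star z) (by rw [map_eval_mul, hRe, hp4])
    obtain ⟨F, hF⟩ := exists_div (A - R * A) z (by
      have : (A - R * A).map (Polynomial.eval z)
          = A.map (Polynomial.eval z) - (R * A).map (Polynomial.eval z) := by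
        ext1 i j; simp
      rw [this, map_eval_mul, hRe, hp3, sub_self])
    have hA : A = (X - C z) • F + (X - C (star z)) • G := by rw [← hG, ← hF]; abel
    have hcz : cj (X - C z) = X - C (star z) := by rw [map_sub, cj_X, cj_C]
    have hcz' : cj (X - C (star z)) = X - C z := by rw [map_sub, cj_X, cj_C, star_star]
    -- cross terms vanish
    have hcross1 : ctr F * G = 0 := by
      have h1 : ctr (A - R * A) * (R * A) = 0 := by
        have : A - R * A = (1 - R) * A := by rw [Matrix.sub_mul, Matrix.one_mul]
        have h1R : ctr (1 - R) = 1 - R := by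
          have : ctr (1 - R) + ctr R = 1 := by
            rw [← ctr_add, sub_add_cancel]
            ext1 i j
            simp only [ctr, Matrix.transpose_apply, Matrix.map_apply, Matrix.one_apply]
            by_cases hij : i = j
            · simp [hij]
            · simp [hij, Ne.symm hij]
          rw [hRc] at this
          exact eq_sub_of_add_eq this
        rw [this, ctr_mul, h1R, Matrix.mul_assoc, ← Matrix.mul_assoc (1 - R), Matrix.sub_mul,
          hRR, Matrix.one_mul, sub_self]
        simp
      rw [hF, hG, ctr_smul, hcz, Matrix.smul_mul, Matrix.mul_smul] at h1
      apply smul_cancel (X_sub_C_ne_zero (star z))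
      apply smul_cancel (X_sub_C_ne_zero (star z))
      rw [h1]; simp
    have hcross2 : ctr G * F = 0 := by
      have h1 : ctr (ctr F * G) = ctr G * F := by
        rw [ctr_mul]
        congr 1
        ext1 i j
        simp only [ctr, Matrix.transpose_apply, Matrix.map_apply]
        simp [cj, Polynomial.map_map]
      rw [← h1, hcross1]
      ext1 i j; simp [ctr]
    apply ih h' (F + G) hm' h'0
    have hne : (X - C z) * (X - C (star z)) ≠ 0 :=
      mul_ne_zero (X_sub_C_ne_zero _) (X_sub_C_ne_zero _)
    apply smul_cancel hne
    have e1 : ctr A * A = ((X - C z) * (X - C (star z))) • (ctr F * F + ctr G * G) := by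
      conv_lhs => rw [hA]
      rw [ctr_add, ctr_smul, ctr_smul, hcz, hcz', Matrix.add_mul, Matrix.mul_add, Matrix.mul_add]
      simp only [Matrix.smul_mul, Matrix.mul_smul, hcross1, hcross2, smul_zero, add_zero, zero_add,
        smul_smul, smul_add]
      rw [mul_comm (X - C z)]
    have e2 : ctr (F + G) * (F + G) = ctr F * F + ctr G * G := by
      rw [ctr_add, Matrix.add_mul, Matrix.mul_add, Matrix.mul_add, hcross1, hcross2]; simp
    rw [e2, ← e1, ← hQ, smul_smul, map_mul, hcz]
    congr 1
    ring

theorem exists_re_im (p : ℂ[X]) : ∃ a b : ℝ[X],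
    p = a.map Complex.ofRealHom + C Complex.I * b.map Complex.ofRealHom := by
  induction p using Polynomial.induction_on' with
  | add p q hp hq =>
    obtain ⟨a, b, rfl⟩ := hp
    obtain ⟨c, d, rfl⟩ := hq
    exact ⟨a + c, b + d, by simp only [Polynomial.map_add]; ring⟩
  | monomial n z =>
    refine ⟨monomial n z.re, monomial n z.im, ?_⟩
    rw [Polynomial.map_monomial, Polynomial.map_monomial, C_mul_monomial, ← map_add]
    congr 1
    apply Complex.ext <;> simp

theorem real_part_eq (p a b : ℝ[X]) (h : p.map Complex.ofRealHom =
    a.map Complex.ofRealHom + C Complex.I * b.map Complex.ofRealHom) : p = a := by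
  ext k
  have := congrArg (fun q => (q.coeff k).re) h
  simpa using this

theorem psd_sos {n : ℕ} (Q : Matrix (Fin n) (Fin n) ℝ[X])
    (hQ : ∀ t, (Q.map (Polynomial.eval t)).PosSemidef) : IsSosMatrix Q := by
  obtain ⟨h, h0, r, A, hA⟩ := exists_denom Finset.univ Q hQ (by simp)
  let φ : ℝ[X] →+* ℂ[X] := Polynomial.mapRingHom Complex.ofRealHom
  have hφ : ∀ p, cj (φ p) = φ p := by
    intro p
    simp only [cj, φ, Polynomial.coe_mapRingHom, Polynomial.map_map]
    congr 1
    ext x; simp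
  obtain ⟨A', hA'⟩ := remove_denom (Q.map φ) _ (φ h) (A.map φ) rfl
    (by simpa [φ, Polynomial.map_eq_zero] using h0) (by
      have h1 : ctr (A.map φ) = Aᵀ.map φ := by
        ext1 i j; simp [ctr, hφ]
      rw [h1, ← Matrix.map_mul, ← hA, hφ]
      ext1 i j; simp [sq])
  have hex : ∀ i j, ∃ a b : ℝ[X], A' i j = φ a + C Complex.I * φ b := fun i j => exists_re_im _
  choose B D hBD using hex
  have : Q = (Matrix.of B)ᵀ * Matrix.of B + (Matrix.of D)ᵀ * Matrix.of D := by
    ext1 i j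
    apply real_part_eq _ _ (∑ k, (B k i * D k j - D k i * B k j))
    have h1 := congrFun (congrFun hA' i) j
    simp only [Matrix.map_apply, Matrix.mul_apply, ctr, Matrix.transpose_apply] at h1
    change φ _ = φ _ + _ * φ _
    rw [h1]
    simp only [Matrix.add_apply, Matrix.mul_apply, Matrix.transpose_apply, Matrix.of_apply,
      map_add, map_sum, Finset.mul_sum, ← Finset.sum_add_distrib]
    refine Finset.sum_congr rfl fun k _ => ?_
    have hI : (C Complex.I : ℂ[X]) * C Complex.I = -1 := by
      rw [← C_mul, Complex.I_mul_I]; simp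
    have hI' : cj (C Complex.I) = - C Complex.I := by
      rw [cj_C]; simp
    rw [hBD, hBD, map_add, map_mul, hφ, hφ, hI']
    simp only [map_mul, map_sub]
    linear_combination (-(φ (D k i) * φ (D k j))) * hI
  rw [this]
  exact sos_add ⟨_, _, rfl⟩ ⟨_, _, rfl⟩
theorem sum_sq_degree {r d : ℕ} (f : Fin r → ℝ[X]) (h : (∑ k, f k * f k).natDegree ≤ 2 * d) :
    ∀ k, (f k).natDegree ≤ d := by
  by_contra! hcon
  obtain ⟨k0, hk0⟩ := hcon
  obtain ⟨k, -, hk⟩ := Finset.exists_max_image Finset.univ (fun k => (f k).natDegree)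
    ⟨k0, Finset.mem_univ _⟩
  set m := (f k).natDegree with hm
  have hlt : d < m := lt_of_lt_of_le hk0 (hk k0 (Finset.mem_univ _))
  have hc : (∑ k, f k * f k).coeff (m + m) = 0 := coeff_eq_zero_of_natDegree_lt (by omega)
  rw [finset_sum_coeff] at hc
  have h2 : ∀ j, (f j * f j).coeff (m + m) = (f j).coeff m * (f j).coeff m := fun j =>
    coeff_mul_add_eq_of_natDegree_le (hk j (Finset.mem_univ _)) (hk j (Finset.mem_univ _))
  simp only [h2] at hc
  rw [Finset.sum_eq_zero_iff_of_nonneg (fun j _ => mul_self_nonneg _)] at hc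
  have h3 := mul_self_eq_zero.mp (hc k (Finset.mem_univ _))
  rw [hm, coeff_natDegree, leadingCoeff_eq_zero] at h3
  rw [h3] at hm
  simp at hm
  omega

/-- homogenization of `p` in formal degree `d`, evaluated at a pair of polynomials -/
noncomputable def hmg (d : ℕ) (p a b : ℝ[X]) : ℝ[X] :=
  ∑ j ∈ Finset.range (d + 1), C (p.coeff j) * a ^ j * b ^ (d - j)

theorem hmg_eval {d : ℕ} {p : ℝ[X]} (hp : p.natDegree ≤ d) (a b : ℝ[X]) (t x : ℝ)
    (hx : a.eval t = x * b.eval t) :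
    (hmg d p a b).eval t = (b.eval t) ^ d * p.eval x := by
  rw [hmg, eval_finset_sum, eval_eq_sum_range' (Nat.lt_succ_of_le hp) x, Finset.mul_sum]
  refine Finset.sum_congr rfl fun j hj => ?_
  have hj' : j ≤ d := Nat.lt_succ_iff.mp (Finset.mem_range.mp hj)
  simp only [eval_mul, eval_C, eval_pow, hx, mul_pow]
  rw [← Nat.add_sub_of_le hj', pow_add]
  simp only [Nat.add_sub_cancel_left]
  ring

theorem hmg_degree {d e : ℕ} (p a b : ℝ[X]) (ha : a.natDegree ≤ e) (hb : b.natDegree ≤ e) :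
    (hmg d p a b).natDegree ≤ d * e := by
  apply natDegree_sum_le_of_forall_le
  intro j hj
  have hj' : j ≤ d := Nat.lt_succ_iff.mp (Finset.mem_range.mp hj)
  calc (C (p.coeff j) * a ^ j * b ^ (d - j)).natDegree
      ≤ (0 + j * e) + (d - j) * e := by
        refine natDegree_mul_le_of_le (natDegree_mul_le_of_le (by simp) ?_) ?_
        · exact natDegree_pow_le_of_le _ ha
        · exact natDegree_pow_le_of_le _ hb
    _ = d * e := by rw [zero_add, ← add_mul, Nat.add_sub_of_le hj']

theorem even_odd (k : ℕ) (p : ℝ[X]) (hp : p.natDegree ≤ 2 * k + 1) : ∃ e o : ℝ[X],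
    e.natDegree ≤ k ∧ o.natDegree ≤ k ∧ ∀ s, p.eval s = e.eval (s ^ 2) + s * o.eval (s ^ 2) := by
  refine ⟨∑ j ∈ Finset.range (k + 1), C (p.coeff (2 * j)) * X ^ j,
    ∑ j ∈ Finset.range (k + 1), C (p.coeff (2 * j + 1)) * X ^ j, ?_, ?_, ?_⟩
  · apply natDegree_sum_le_of_forall_le
    intro j hj
    exact (natDegree_C_mul_X_pow_le _ _).trans (Nat.lt_succ_iff.mp (Finset.mem_range.mp hj))
  · apply natDegree_sum_le_of_forall_le
    intro j hj
    exact (natDegree_C_mul_X_pow_le _ _).trans (Nat.lt_succ_iff.mp (Finset.mem_range.mp hj))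
  · intro s
    rw [eval_eq_sum_range' (n := 2 * (k + 1)) (by omega) s]
    simp only [eval_finset_sum, eval_mul, eval_C, eval_pow, eval_X]
    generalize k + 1 = m
    induction m with
    | zero => simp
    | succ m ih =>
      rw [show 2 * (m + 1) = 2 * m + 1 + 1 by ring, Finset.sum_range_succ, Finset.sum_range_succ,
        ih, Finset.sum_range_succ, Finset.sum_range_succ]
      ring

theorem sos_eval_psd {n : ℕ} {Y : Matrix (Fin n) (Fin n) ℝ[X]} (hY : IsSosMatrix Y) (t : ℝ) :
    (Y.map (Polynomial.eval t)).PosSemidef := by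
  obtain ⟨r, A, rfl⟩ := hY
  have := Matrix.posSemidef_conjTranspose_mul_self (A.map (Polynomial.eval t))
  convert this using 1
  ext i j
  simp [Matrix.mul_apply, eval_finset_sum]

theorem forward {n d : ℕ} (hd : Odd d) (P : Matrix (Fin n) (Fin n) (Polynomial ℝ))
    (hdeg : ∀ i j, (P i j).natDegree ≤ d)
    (hP : ∀ t ∈ Set.Icc (-1 : ℝ) 1, (P.map (Polynomial.eval t)).PosSemidef) :
    ∃ X₁ X₂ : Matrix (Fin n) (Fin n) (Polynomial ℝ),
      IsSosMatrix X₁ ∧ IsSosMatrix X₂ ∧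
      (∀ i j, (X₁ i j).natDegree ≤ d - 1) ∧ (∀ i j, (X₂ i j).natDegree ≤ d - 1) ∧
      P = ((Polynomial.X : Polynomial ℝ) + 1) • X₁ +
            (1 - (Polynomial.X : Polynomial ℝ)) • X₂ := by
  obtain ⟨k, rfl⟩ := hd
  set d := 2 * k + 1 with hdk
  let Q : Matrix (Fin n) (Fin n) ℝ[X] := Matrix.of fun i j => hmg d (P i j) (X ^ 2 - 1) (X ^ 2 + 1)
  have hQe : ∀ s i j, (Q i j).eval s =
      (s ^ 2 + 1) ^ d * (P i j).eval ((s ^ 2 - 1) / (s ^ 2 + 1)) := by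
    intro s i j
    have hpos : s ^ 2 + 1 ≠ 0 := by positivity
    have := hmg_eval (hdeg i j) (X ^ 2 - 1) (X ^ 2 + 1) s ((s ^ 2 - 1) / (s ^ 2 + 1)) (by
      simp; field_simp)
    simpa [Q] using this
  obtain ⟨r, A, hA⟩ := psd_sos Q (by
    intro s
    have hpos : 0 < s ^ 2 + 1 := by positivity
    have h1 := (hP ((s ^ 2 - 1) / (s ^ 2 + 1)) (by
      constructor
      · rw [le_div_iff₀ hpos]; nlinarith [sq_nonneg s]
      · rw [div_le_iff₀ hpos]; linarith)).smul (α := ℝ) (pow_nonneg hpos.le d)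
    convert h1 using 1
    ext i j
    simp [hQe])
  have hAe : ∀ i j, Q i j = ∑ l, A l i * A l j := by
    intro i j; rw [hA]; simp [Matrix.mul_apply]
  have hAdeg : ∀ l i, (A l i).natDegree ≤ 2 * k + 1 := by
    intro l i
    refine sum_sq_degree (fun l => A l i) ?_ l
    rw [← hAe, mul_comm]
    exact hmg_degree _ _ _ (by compute_degree) (by compute_degree)
  choose E O hE hO hEO using fun l i => even_odd k (A l i) (hAdeg l i)
  let c : ℝ := Real.sqrt ((1 / 2) ^ d)
  have hc : c * c = (1 / 2) ^ d := Real.mul_self_sqrt (by positivity)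
  let E' : Matrix (Fin r) (Fin n) ℝ[X] := Matrix.of fun l i => C c * hmg k (E l i) (1 + X) (1 - X)
  let O' : Matrix (Fin r) (Fin n) ℝ[X] := Matrix.of fun l i => C c * hmg k (O l i) (1 + X) (1 - X)
  have hd1 : ∀ p : ℝ[X], (C c * hmg k p (1 + X) (1 - X)).natDegree ≤ k := by
    intro p
    refine (natDegree_C_mul_le _ _).trans ?_
    simpa using hmg_degree (d := k) (e := 1) p (1 + X) (1 - X) (by compute_degree)
      (by compute_degree)
  have hdeg2 : ∀ B : Matrix (Fin r) (Fin n) ℝ[X], (∀ l i, (B l i).natDegree ≤ k) →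
      ∀ i j, ((Bᵀ * B) i j).natDegree ≤ d - 1 := by
    intro B hB i j
    rw [Matrix.mul_apply]
    apply natDegree_sum_le_of_forall_le
    intro l _
    refine (natDegree_mul_le_of_le (hB l i) (hB l j)).trans ?_
    omega
  refine ⟨O'ᵀ * O', E'ᵀ * E', ⟨_, _, rfl⟩, ⟨_, _, rfl⟩, hdeg2 _ fun l i => hd1 _,
    hdeg2 _ fun l i => hd1 _, ?_⟩
  ext1 i j
  apply Polynomial.eq_of_infinite_eval_eq
  refine Set.Infinite.mono ?_ (Set.Ioo_infinite (show (-1 : ℝ) < 1 by norm_num))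
  intro t ht
  obtain ⟨ht1, ht2⟩ := ht
  have h1 : 0 < 1 - t := by linarith
  have h2 : 0 < 1 + t := by linarith
  obtain ⟨s, hs⟩ : ∃ s : ℝ, s ^ 2 = (1 + t) / (1 - t) :=
    ⟨Real.sqrt ((1 + t) / (1 - t)), Real.sq_sqrt (by positivity)⟩
  have hst : (s ^ 2 - 1) / (s ^ 2 + 1) = t := by
    rw [hs]; field_simp; ring
  have hst1 : s ^ 2 + 1 = 2 / (1 - t) := by
    rw [hs]; field_simp; ring
  -- even part of the identity
  have hev : ∀ s, (Q i j).eval s = ∑ l, ((E l i).eval (s ^ 2) + s * (O l i).eval (s ^ 2)) *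
      ((E l j).eval (s ^ 2) + s * (O l j).eval (s ^ 2)) := by
    intro s
    rw [hAe, eval_finset_sum]
    refine Finset.sum_congr rfl fun l _ => ?_
    rw [eval_mul, hEO, hEO]
  have hsum : (Q i j).eval s = ∑ l, ((E l i).eval (s ^ 2) * (E l j).eval (s ^ 2) +
      s ^ 2 * ((O l i).eval (s ^ 2) * (O l j).eval (s ^ 2))) := by
    have e1 := hev s
    have e2 := hev (-s)
    have e3 : (Q i j).eval (-s) = (Q i j).eval s := by rw [hQe, hQe, neg_sq]
    rw [e3, neg_sq] at e2
    have : 2 * (Q i j).eval s = 2 * ∑ l, ((E l i).eval (s ^ 2) * (E l j).eval (s ^ 2) +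
      s ^ 2 * ((O l i).eval (s ^ 2) * (O l j).eval (s ^ 2))) := by
      rw [two_mul]
      nth_rewrite 1 [e1]
      rw [e2, ← Finset.sum_add_distrib, Finset.mul_sum]
      refine Finset.sum_congr rfl fun l _ => ?_
      ring
    linarith
  rw [hQe, hst, hst1] at hsum
  have hE' : ∀ l i, (E' l i).eval t = c * ((1 - t) ^ k * (E l i).eval (s ^ 2)) := by
    intro l i
    have := hmg_eval (hE l i) (1 + X) (1 - X) t (s ^ 2) (by simp [hs]; field_simp)
    simp only [E', Matrix.of_apply, eval_mul, eval_C, this]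
    simp
  have hO' : ∀ l i, (O' l i).eval t = c * ((1 - t) ^ k * (O l i).eval (s ^ 2)) := by
    intro l i
    have := hmg_eval (hO l i) (1 + X) (1 - X) t (s ^ 2) (by simp [hs]; field_simp)
    simp only [O', Matrix.of_apply, eval_mul, eval_C, this]
    simp
  have hPt : (P i j).eval t = ((1 - t) / 2) ^ d * ((2 / (1 - t)) ^ d * (P i j).eval t) := by
    rw [← mul_assoc, ← mul_pow, show (1 - t) / 2 * (2 / (1 - t)) = 1 by field_simp]; simp
  change (P i j).eval t = _
  rw [hPt, hsum]
  simp only [Matrix.add_apply, Matrix.smul_apply, smul_eq_mul, Matrix.mul_apply,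
    Matrix.transpose_apply, eval_add, eval_mul, eval_sub, eval_X, eval_one, eval_finset_sum,
    hE', hO', Finset.mul_sum, ← Finset.sum_add_distrib]
  refine Finset.sum_congr rfl fun l _ => ?_
  have hst2 : s ^ 2 * (1 - t) = t + 1 := by rw [hs]; field_simp; ring
  have hpow : ((1 - t) / 2) ^ d = c * c * ((1 - t) ^ k * (1 - t) ^ k * (1 - t)) := by
    rw [hc, div_eq_mul_one_div, mul_pow, mul_comm, hdk]; ring
  rw [hpow]
  linear_combination (c * c * (1 - t) ^ k * (1 - t) ^ k *
    ((O l i).eval (s ^ 2) * (O l j).eval (s ^ 2))) * hst2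

/-- for a symmetric univariate polynomial matrix `P(t)` of odd degree at most
`d`, `P(t) ⪰ 0` for all `t ∈ [-1,1]` if and only if there exist sos-matrices `X₁(t)`, `X₂(t)`
of degree at most `d-1` such that `P(t) = (t+1)·X₁(t) + (1-t)·X₂(t)` identically. -/
theorem stmt_3 {n d : ℕ} (hd : Odd d) (P : Matrix (Fin n) (Fin n) (Polynomial ℝ))
    (hsymm : P.IsSymm) (hdeg : ∀ i j, (P i j).natDegree ≤ d) :
    (∀ t ∈ Set.Icc (-1 : ℝ) 1, (P.map (Polynomial.eval t)).PosSemidef) ↔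
    ∃ X₁ X₂ : Matrix (Fin n) (Fin n) (Polynomial ℝ),
      IsSosMatrix X₁ ∧ IsSosMatrix X₂ ∧
      (∀ i j, (X₁ i j).natDegree ≤ d - 1) ∧ (∀ i j, (X₂ i j).natDegree ≤ d - 1) ∧
      P = ((Polynomial.X : Polynomial ℝ) + 1) • X₁ +
            (1 - (Polynomial.X : Polynomial ℝ)) • X₂ := by
  constructor
  · exact forward hd P hdeg
  · rintro ⟨X₁, X₂, h1, h2, -, -, rfl⟩ t ⟨ht1, ht2⟩
    have := ((sos_eval_psd h1 t).smul (α := ℝ) (show 0 ≤ t + 1 by linarith)).add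
      ((sos_eval_psd h2 t).smul (α := ℝ) (show 0 ≤ 1 - t by linarith))
    convert this using 1
    ext i j
    simp
end

section
/- Let P(t) be a symmetric n×n univariate polynomial matrix of degree at most d, where d is even. Then P(t) is positive semidefinite for every t ∈ [-1,1] if and only if there exist sos-matrices X₁(t) of degree at most d and X₂(t) of degree at most d-2 such that P(t) = X₁(t) + (1-t²)·X₂(t) for all t ∈ ℝ. -/
open Matrix Polynomial

open scoped MatrixOrder in
lemma aux_fac {m : Type*} [Fintype m] [DecidableEq m] {G : Matrix m m ℝ} (hG : G.PosSemidef) :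
    ∃ R : Matrix m m ℝ, G = Rᵀ * R := by
  obtain ⟨B, hB⟩ := CStarAlgebra.nonneg_iff_eq_star_mul_self.mp hG.nonneg
  exact ⟨B, hB⟩

lemma aux_pinv {m : Type*} [Fintype m] [DecidableEq m] (G : Matrix m m ℝ) (hG : G.IsHermitian) :
    ∃ Z : Matrix m m ℝ, Zᵀ = Z ∧ G * Z * G = G := by
  have h := hG.spectral_theorem
  rw [Unitary.conjStarAlgAut_apply] at h
  set U : Matrix m m ℝ := (hG.eigenvectorUnitary : Matrix m m ℝ)
  have hU : star U * U = 1 := Unitary.coe_star_mul_self hG.eigenvectorUnitary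
  set D : Matrix m m ℝ := diagonal (RCLike.ofReal ∘ hG.eigenvalues)
  let E : Matrix m m ℝ := diagonal (fun i => (hG.eigenvalues i)⁻¹)
  have hDE : D * E * D = D := by
    simp [D, E, diagonal_mul_diagonal]
  refine ⟨U * E * star U, ?_, ?_⟩
  · simp [E, star_eq_conjTranspose, conjTranspose_eq_transpose_of_trivial, Matrix.mul_assoc]
  · have h' : G = U * D * star U := h
    calc G * (U * E * star U) * G = (U * D * star U) * (U * E * star U) * (U * D * star U) := by rw [← h']
      _ = U * D * (star U * U) * E * (star U * U) * D * star U := by simp only [Matrix.mul_assoc]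
      _ = U * (D * E * D) * star U := by rw [hU]; simp [Matrix.mul_assoc]
      _ = G := by rw [hDE, ← h']

lemma aux_closed {V E : Type*} [NormedAddCommGroup V] [NormedSpace ℝ V] [FiniteDimensional ℝ V]
    [NormedAddCommGroup E] [NormedSpace ℝ E] [FiniteDimensional ℝ E] (f : V → E) (hf : Continuous f)
    (hh : ∀ (r : ℝ) x, f (r • x) = r ^ 2 • f x) (h0 : ∀ x, f x = 0 → x = 0) :
    IsClosed (Set.range f) := by
  have := FiniteDimensional.proper_real V
  have := FiniteDimensional.proper_real E
  have key : ∃ c > 0, ∀ x, c * ‖x‖ ^ 2 ≤ ‖f x‖ := by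
    rcases (Metric.sphere (0:V) 1).eq_empty_or_nonempty with he | hne
    · refine ⟨1, one_pos, fun x => ?_⟩
      by_cases hx : x = 0
      · simp [hx]
      · exfalso
        have : (‖x‖⁻¹ • x) ∈ Metric.sphere (0:V) 1 := by
          simp [norm_smul, hx]
        rw [he] at this
        exact this
    · obtain ⟨x0, hx0, hmin⟩ := (isCompact_sphere (0:V) 1).exists_isMinOn hne
        (hf.norm.continuousOn)
      refine ⟨‖f x0‖, ?_, fun x => ?_⟩
      · rw [gt_iff_lt, norm_pos_iff]
        intro h
        have := h0 _ h
        simp [this] at hx0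
      · by_cases hx : x = 0
        · simp [hx]
        · have hm : (‖x‖⁻¹ • x) ∈ Metric.sphere (0:V) 1 := by
            simp [norm_smul, hx]
          have h1 := hmin hm
          simp only [Set.mem_ofPred_eq] at h1
          have hxp : 0 < ‖x‖ := norm_pos_iff.2 hx
          have h2 : f x = ‖x‖ ^ 2 • f (‖x‖⁻¹ • x) := by
            rw [← hh, smul_smul, mul_inv_cancel₀ hxp.ne', one_smul]
          rw [h2, norm_smul, norm_pow, norm_norm, mul_comm]
          gcongr
  obtain ⟨c, hc, hk⟩ := key
  have hp : IsProperMap f := by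
    rw [isProperMap_iff_tendsto_cocompact]
    refine ⟨hf, ?_⟩
    rw [← Metric.cobounded_eq_cocompact, ← Metric.cobounded_eq_cocompact,
      ← tendsto_norm_atTop_iff_cobounded]
    refine Filter.tendsto_atTop_mono hk ?_
    refine Filter.Tendsto.const_mul_atTop hc ?_
    exact (Filter.tendsto_pow_atTop two_ne_zero).comp tendsto_norm_cobounded_atTop
  exact hp.isClosedMap.isClosed_range

lemma aux_dual {n k : ℕ} (c : Fin n → Fin n → ℕ → ℝ) (hc : ∀ a b m, c a b m = c b a m)
    (hG : (Matrix.of fun (p q : Fin n × Fin (k+1)) => c p.1 q.1 (p.2+q.2)).PosSemidef)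
    (hH : (Matrix.of fun (p q : Fin n × Fin k) =>
      c p.1 q.1 (p.2+q.2) - c p.1 q.1 (p.2+q.2+2)).PosSemidef) :
    ∃ (l : Fin n × Fin (k+1) → ℝ) (y : Fin n → Fin n × Fin (k+1) → ℝ),
      (∀ s, l s ∈ Set.Icc (-1:ℝ) 1) ∧
      ∀ a b m, m ≤ 2 * k → c a b m = ∑ s, y a s * l s ^ m * y b s := by
  obtain ⟨R, hR⟩ := aux_fac hG
  have hRc : ∀ a i b j, ∑ s, R s (a,i) * R s (b,j) = c a b (i+j) := by
    intro a i b j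
    have := congrFun (congrFun hR (a,i)) (b,j)
    simp [Matrix.mul_apply] at this
    exact this.symm
  let W : Matrix (Fin n × Fin (k+1)) (Fin n × Fin k) ℝ :=
    Matrix.of fun r p => R r (p.1, p.2.succ) + R r (p.1, p.2.castSucc)
  let G' : Matrix (Fin n × Fin k) (Fin n × Fin k) ℝ :=
    Matrix.of fun p q => c p.1 q.1 (p.2+q.2) + c p.1 q.1 (p.2+q.2+1)
  set H : Matrix (Fin n × Fin k) (Fin n × Fin k) ℝ := Matrix.of fun (p q : Fin n × Fin k) =>
      c p.1 q.1 (p.2+q.2) - c p.1 q.1 (p.2+q.2+2) with hHdef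
  have hsum : Wᵀ * W + H = (2:ℝ) • G' := by
    ext ⟨a,i⟩ ⟨b,j⟩
    simp only [Matrix.add_apply, Matrix.mul_apply, Matrix.transpose_apply, W, H, G', Matrix.of_apply,
      Matrix.smul_apply, add_mul, mul_add, Finset.sum_add_distrib, hRc, Fin.val_succ, Fin.val_castSucc]
    rw [show (i:ℕ) + 1 + (j + 1) = i + j + 2 by ring, show (i:ℕ) + (j+1) = i + j + 1 by ring,
      show (i:ℕ) + 1 + j = i + j + 1 by ring]
    simp only [smul_eq_mul]
    ring
  have hG'h : G'.IsHermitian := by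
    ext ⟨a,i⟩ ⟨b,j⟩
    simp [G', hc b a, add_comm (j:ℕ) i]
  obtain ⟨Z, hZ, hGZ⟩ := aux_pinv G' hG'h
  have hG't : G'ᵀ = G' := hG'h
  have hdom : ∀ u : Fin n × Fin k → ℝ, (W *ᵥ u) ⬝ᵥ (W *ᵥ u) ≤ 2 * (u ⬝ᵥ (G' *ᵥ u)) := by
    intro u
    have h1 := hH.dotProduct_mulVec_nonneg u
    simp only [star_trivial] at h1
    have h2 : (W *ᵥ u) ⬝ᵥ (W *ᵥ u) = u ⬝ᵥ ((Wᵀ * W) *ᵥ u) := by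
      rw [← Matrix.mulVec_mulVec, Matrix.dotProduct_mulVec u, Matrix.vecMul_transpose]
    have h3 : 2 * (u ⬝ᵥ (G' *ᵥ u)) = u ⬝ᵥ (((2:ℝ) • G') *ᵥ u) := by
      rw [Matrix.smul_mulVec, dotProduct_smul, smul_eq_mul]
    rw [h3, ← hsum, Matrix.add_mulVec, dotProduct_add, h2]
    linarith
  have hWZ : W * Z * G' = W := by
    have : W * (1 - Z * G') = 0 := by
      ext r p
      have h1 : ∀ v, W *ᵥ ((1 - Z * G') *ᵥ v) = 0 := by
        intro v
        have h2 := hdom ((1 - Z * G') *ᵥ v)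
        have h3 : G' *ᵥ ((1 - Z * G') *ᵥ v) = 0 := by
          rw [Matrix.mulVec_mulVec, mul_sub, ← Matrix.mul_assoc, hGZ]; simp
        rw [h3] at h2
        simp only [dotProduct_zero, mul_zero] at h2
        have h4 : 0 ≤ (W *ᵥ (1 - Z * G') *ᵥ v) ⬝ᵥ (W *ᵥ (1 - Z * G') *ᵥ v) :=
          Finset.sum_nonneg fun i _ => mul_self_nonneg _
        exact dotProduct_self_eq_zero.1 (le_antisymm h2 h4)
      have h5 := congrFun (h1 (Pi.single p 1)) r
      rw [Matrix.mulVec_mulVec] at h5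
      simpa using h5
    rw [Matrix.mul_sub, sub_eq_zero, Matrix.mul_one] at this
    rw [Matrix.mul_assoc, ← this]
  have hWZ' : G' * Z * Wᵀ = Wᵀ := by
    have := congrArg Matrix.transpose hWZ
    rwa [Matrix.transpose_mul, Matrix.transpose_mul, hZ, hG't, ← Matrix.mul_assoc] at this
  let T : Matrix (Fin n × Fin (k+1)) (Fin n × Fin (k+1)) ℝ := W * Z * Wᵀ - 1
  have hT : T.IsHermitian := by
    change Tᵀ = T
    simp [T, hZ, Matrix.mul_assoc]
  have hTr : ∀ b (j : Fin k), T *ᵥ (fun s => R s (b, j.castSucc)) = fun s => R s (b, j.succ) := by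
    intro b j
    have h1 : Wᵀ *ᵥ (fun s => R s (b, j.castSucc)) = G' *ᵥ Pi.single (b,j) 1 := by
      ext ⟨a,i⟩
      simp only [Matrix.mulVec, dotProduct, Matrix.transpose_apply, W, G', Matrix.of_apply, add_mul,
        Finset.sum_add_distrib, hRc, Fin.val_succ, Fin.val_castSucc]
      simp [Pi.single_apply]
      rw [show (i:ℕ) + 1 + j = i + j + 1 by ring, add_comm]
    simp only [T]
    rw [Matrix.sub_mulVec, ← Matrix.mulVec_mulVec, h1, Matrix.mulVec_mulVec, hWZ]
    ext s
    simp [W]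
  have hl : ∀ s, hT.eigenvalues s ∈ Set.Icc (-1:ℝ) 1 := by
    intro s
    have h1 := hT.mulVec_eigenvectorBasis s
    set v : Fin n × Fin (k+1) → ℝ := (hT.eigenvectorBasis s).ofLp with hv
    have hv0 : v ≠ 0 := by
      intro h
      have := hT.eigenvectorBasis.orthonormal.ne_zero s
      apply this
      ext i
      exact congrFun h i
    set μ := hT.eigenvalues s
    have hvp : 0 < v ⬝ᵥ v := by
      have h4 : 0 ≤ v ⬝ᵥ v := Finset.sum_nonneg fun i _ => mul_self_nonneg _
      exact lt_of_le_of_ne h4 (fun h => hv0 (dotProduct_self_eq_zero.1 h.symm))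
    set u := Z *ᵥ (Wᵀ *ᵥ v) with hu
    have h2 : W *ᵥ u = (μ + 1) • v := by
      rw [hu, Matrix.mulVec_mulVec, Matrix.mulVec_mulVec]
      simp only [T, Matrix.sub_mulVec, Matrix.one_mulVec] at h1
      rw [sub_eq_iff_eq_add] at h1
      rw [h1, add_smul, one_smul]
    have h3 : G' *ᵥ u = Wᵀ *ᵥ v := by
      rw [hu, Matrix.mulVec_mulVec, Matrix.mulVec_mulVec, hWZ']
    have h4 := hdom u
    have h5 : u ⬝ᵥ (Wᵀ *ᵥ v) = (μ + 1) * (v ⬝ᵥ v) := by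
      rw [Matrix.dotProduct_mulVec, Matrix.vecMul_transpose, h2, smul_dotProduct, smul_eq_mul]
    rw [h3, h5, h2, smul_dotProduct, dotProduct_smul, smul_eq_mul, smul_eq_mul] at h4
    have h6 : (μ + 1) * (μ + 1) ≤ 2 * (μ + 1) := by
      by_contra hcon
      push Not at hcon
      nlinarith
    constructor <;> nlinarith
  let e : Fin n × Fin (k+1) → Fin n × Fin (k+1) → ℝ := fun s => (hT.eigenvectorBasis s).ofLp
  have hpars : ∀ v w : Fin n × Fin (k+1) → ℝ, v ⬝ᵥ w = ∑ s, (e s ⬝ᵥ v) * (e s ⬝ᵥ w) := by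
    intro v w
    have := hT.eigenvectorBasis.sum_inner_mul_inner (WithLp.toLp 2 v) (WithLp.toLp 2 w)
    simp only [EuclideanSpace.inner_eq_star_dotProduct, star_trivial] at this
    rw [dotProduct_comm v w, ← this]
    refine Finset.sum_congr rfl fun s _ => ?_
    rw [dotProduct_comm w]
  have hstep : ∀ s b (i : ℕ) (hi : i < k + 1), e s ⬝ᵥ (fun r => R r (b, ⟨i,hi⟩)) =
      hT.eigenvalues s ^ i * (e s ⬝ᵥ (fun r => R r (b, 0))) := by
    intro s b i
    induction i with
    | zero => intro hi; simp
    | succ i ih =>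
      intro hi
      have h1 := hTr b ⟨i, by omega⟩
      have h2 : (fun r => R r (b, ⟨i+1,hi⟩)) = T *ᵥ (fun r => R r (b, ⟨i, by omega⟩)) := h1.symm
      have hTt : Tᵀ = T := hT
      have h3 : e s ᵥ* T = hT.eigenvalues s • e s := by
        rw [← hT.mulVec_eigenvectorBasis s, ← Matrix.vecMul_transpose, hTt]
      rw [h2, Matrix.dotProduct_mulVec, h3, smul_dotProduct, ih, smul_eq_mul, pow_succ]
      ring
  refine ⟨hT.eigenvalues, fun a s => e s ⬝ᵥ (fun r => R r (a, 0)), hl, ?_⟩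
  intro a b m hm
  obtain ⟨i, j, hi, hj, rfl⟩ : ∃ i j, i < k + 1 ∧ j < k + 1 ∧ m = i + j :=
    ⟨min m k, m - min m k, by omega, by omega, by omega⟩
  have h1 := hRc a ⟨i,hi⟩ b ⟨j,hj⟩
  simp only at h1
  rw [← h1]
  have h2 := hpars (fun r => R r (a, ⟨i,hi⟩)) (fun r => R r (b, ⟨j,hj⟩))
  rw [dotProduct] at h2
  rw [h2]
  refine Finset.sum_congr rfl fun s _ => ?_
  rw [hstep s a i hi, hstep s b j hj, pow_add]
  ring

/-- The polynomial matrix with coefficient matrix `A`. -/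
noncomputable def auxPm {ι : Type*} {n k : ℕ} (A : Matrix ι (Fin n × Fin k) ℝ) :
    Matrix ι (Fin n) (Polynomial ℝ) :=
  Matrix.of fun r a => ∑ i : Fin k, C (A r (a, i)) * X ^ (i : ℕ)

/-- The polynomial matrix with Gram matrix `G`. -/
noncomputable def auxGp {n k : ℕ} (G : Matrix (Fin n × Fin k) (Fin n × Fin k) ℝ) :
    Matrix (Fin n) (Fin n) (Polynomial ℝ) :=
  Matrix.of fun a b => ∑ i : Fin k, ∑ j : Fin k, C (G (a, i) (b, j)) * X ^ ((i : ℕ) + j)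

lemma auxGp_fac {ι : Type*} [Fintype ι] {n k : ℕ} (A : Matrix ι (Fin n × Fin k) ℝ) :
    auxGp (Aᵀ * A) = (auxPm A)ᵀ * auxPm A := by
  ext1 a b
  simp only [auxGp, auxPm, Matrix.mul_apply, Matrix.of_apply, Matrix.transpose_apply,
    Finset.sum_mul_sum, map_sum, map_mul]
  conv_rhs => rw [Finset.sum_comm]
  refine Finset.sum_congr rfl fun i _ => ?_
  conv_rhs => rw [Finset.sum_comm]
  refine Finset.sum_congr rfl fun j _ => ?_
  rw [Finset.sum_mul]
  refine Finset.sum_congr rfl fun r _ => ?_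
  ring

lemma auxPm_coeff {ι : Type*} {n k : ℕ} (A : Matrix ι (Fin n × Fin k) ℝ) (r a) (i : Fin k) :
    (auxPm A r a).coeff i = A r (a, i) := by
  simp [auxPm, Polynomial.finsetSum_coeff, Polynomial.coeff_C_mul, Polynomial.coeff_X_pow,
    Fin.val_inj]

lemma auxGp_deg {n k : ℕ} (G : Matrix (Fin n × Fin k) (Fin n × Fin k) ℝ) (a b) :
    (auxGp G a b).natDegree ≤ 2 * k - 2 := by
  simp only [auxGp, Matrix.of_apply]
  refine Polynomial.natDegree_sum_le_of_forall_le _ _ fun i _ => ?_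
  refine Polynomial.natDegree_sum_le_of_forall_le _ _ fun j _ => ?_
  refine (Polynomial.natDegree_C_mul_X_pow_le _ _).trans ?_
  omega

lemma auxGp_sos {n k : ℕ} {G : Matrix (Fin n × Fin k) (Fin n × Fin k) ℝ} (hG : G.PosSemidef) :
    IsSosMatrix (auxGp G) := by
  obtain ⟨R, rfl⟩ := aux_fac hG
  rw [auxGp_fac]
  let e := Fintype.equivFin (Fin n × Fin k)
  refine ⟨_, (auxPm R).submatrix e.symm id, ?_⟩
  ext1 a b
  simp only [Matrix.mul_apply, Matrix.transpose_apply, Matrix.submatrix_apply, id]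
  exact (e.symm.sum_comp (fun x => auxPm R x a * auxPm R x b)).symm

lemma auxGp_add {n k : ℕ} (G H : Matrix (Fin n × Fin k) (Fin n × Fin k) ℝ) (a b) :
    auxGp (G + H) a b = auxGp G a b + auxGp H a b := by
  simp only [auxGp, Matrix.of_apply, Matrix.add_apply, map_add, add_mul, Finset.sum_add_distrib]

lemma auxGp_smul {n k : ℕ} (r : ℝ) (G : Matrix (Fin n × Fin k) (Fin n × Fin k) ℝ) (a b) :
    auxGp (r • G) a b = r • auxGp G a b := by
  simp only [auxGp, Matrix.of_apply, Matrix.smul_apply, smul_eq_mul, map_mul, Finset.smul_sum,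
    Polynomial.smul_eq_C_mul, mul_assoc]

/-- The coefficient vector of `gp G₁ + (1 - X²) gp G₂`. -/
noncomputable def auxPsi (n k : ℕ) :
    ((Fin n × Fin (k+1) → Fin n × Fin (k+1) → ℝ) × (Fin n × Fin k → Fin n × Fin k → ℝ)) →ₗ[ℝ]
      (Fin n → Fin n → Fin (2 * k + 1) → ℝ) where
  toFun g := fun a b m =>
    (auxGp (Matrix.of g.1) a b + (1 - X ^ 2) * auxGp (Matrix.of g.2) a b).coeff m
  map_add' g h := by
    ext a b m
    simp only [Pi.add_apply, ← Polynomial.coeff_add, Prod.fst_add, Prod.snd_add, ← Matrix.of_add_of,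
      auxGp_add]
    congr 1
    ring
  map_smul' r g := by
    ext a b m
    simp only [Pi.smul_apply, RingHom.id_apply, ← Polynomial.coeff_smul, Prod.smul_fst,
      Prod.smul_snd, ← Matrix.smul_of, auxGp_smul, smul_add, mul_smul_comm]

lemma auxTot_deg {n k : ℕ} (G₁ : Matrix (Fin n × Fin (k+1)) (Fin n × Fin (k+1)) ℝ)
    (G₂ : Matrix (Fin n × Fin k) (Fin n × Fin k) ℝ) (a b) :
    (auxGp G₁ a b + (1 - X ^ 2) * auxGp G₂ a b).natDegree ≤ 2 * k := by
  refine Polynomial.natDegree_add_le_of_degree_le ((auxGp_deg _ _ _).trans (by omega)) ?_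
  cases k with
  | zero => simp [auxGp]
  | succ k =>
    refine Polynomial.natDegree_mul_le.trans ?_
    have h1 := auxGp_deg G₂ a b
    have h2 : (1 - X ^ 2 : Polynomial ℝ).natDegree ≤ 2 := by compute_degree
    omega

lemma auxCoeff_inj {p q : Polynomial ℝ} {N : ℕ} (hp : p.natDegree ≤ N) (hq : q.natDegree ≤ N)
    (h : ∀ m : Fin (N + 1), p.coeff m = q.coeff m) : p = q := by
  ext m
  by_cases hm : m < N + 1
  · exact h ⟨m, hm⟩
  · rw [Polynomial.coeff_eq_zero_of_natDegree_lt (by omega),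
      Polynomial.coeff_eq_zero_of_natDegree_lt (by omega)]

lemma auxPm_zero {ι : Type*} {n k : ℕ} (A : Matrix ι (Fin n × Fin k) ℝ)
    (h : ∀ t ∈ Set.Ioo (-1:ℝ) 1, ∀ r a, (auxPm A r a).eval t = 0) : A = 0 := by
  ext r ⟨a, i⟩
  have : auxPm A r a = 0 := by
    refine Polynomial.eq_zero_of_infinite_isRoot _ ?_
    exact (Set.Ioo_infinite (by norm_num : (-1:ℝ) < 1)).mono fun t ht => h t ht r a
  rw [← auxPm_coeff A r a i, this]; simp

lemma auxSq_zero {ι κ : Type*} [Fintype ι] [Fintype κ] {n k l : ℕ} (A : Matrix ι (Fin n × Fin k) ℝ)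
    (B : Matrix κ (Fin n × Fin l) ℝ)
    (h : ∀ a, auxGp (Aᵀ * A) a a + (1 - X ^ 2) * auxGp (Bᵀ * B) a a = 0) : A = 0 ∧ B = 0 := by
  have key : ∀ t ∈ Set.Ioo (-1:ℝ) 1, ∀ a, (∀ r, (auxPm A r a).eval t = 0) ∧
      (∀ r, (auxPm B r a).eval t = 0) := by
    intro t ht a
    have h1 := congrArg (Polynomial.eval t) (h a)
    rw [auxGp_fac, auxGp_fac] at h1
    simp only [Matrix.mul_apply, Matrix.transpose_apply, Polynomial.eval_add, Polynomial.eval_mul,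
      Polynomial.eval_finsetSum, Polynomial.eval_sub, Polynomial.eval_one, Polynomial.eval_pow,
      Polynomial.eval_X, Polynomial.eval_zero] at h1
    have ht2 : 0 < 1 - t ^ 2 := by nlinarith [ht.1, ht.2]
    have hA : 0 ≤ ∑ r, (auxPm A r a).eval t * (auxPm A r a).eval t :=
      Finset.sum_nonneg fun _ _ => mul_self_nonneg _
    have hB : 0 ≤ ∑ r, (auxPm B r a).eval t * (auxPm B r a).eval t :=
      Finset.sum_nonneg fun _ _ => mul_self_nonneg _
    have hA0 : ∑ r, (auxPm A r a).eval t * (auxPm A r a).eval t = 0 := by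
      nlinarith [mul_nonneg ht2.le hB]
    have hB0 : ∑ r, (auxPm B r a).eval t * (auxPm B r a).eval t = 0 := by
      rw [hA0, zero_add] at h1
      exact (mul_eq_zero.1 h1).resolve_left ht2.ne'
    rw [Finset.sum_eq_zero_iff_of_nonneg (fun _ _ => mul_self_nonneg _)] at hA0 hB0
    exact ⟨fun r => mul_self_eq_zero.1 (hA0 r (Finset.mem_univ _)),
      fun r => mul_self_eq_zero.1 (hB0 r (Finset.mem_univ _))⟩
  exact ⟨auxPm_zero A fun t ht r a => (key t ht a).1 r,
    auxPm_zero B fun t ht r a => (key t ht a).2 r⟩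

/-- The cone of coefficient vectors of representable matrices. -/
def auxCone (n k : ℕ) : Set (Fin n → Fin n → Fin (2 * k + 1) → ℝ) :=
  {v | ∃ (G₁ : Matrix (Fin n × Fin (k+1)) (Fin n × Fin (k+1)) ℝ)
    (G₂ : Matrix (Fin n × Fin k) (Fin n × Fin k) ℝ), G₁.PosSemidef ∧ G₂.PosSemidef ∧
    v = auxPsi n k (G₁, G₂)}

lemma auxCone_smul {n k : ℕ} {v} (hv : v ∈ auxCone n k) {r : ℝ} (hr : 0 ≤ r) :
    r • v ∈ auxCone n k := by
  obtain ⟨G₁, G₂, h1, h2, rfl⟩ := hv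
  exact ⟨r • G₁, r • G₂, h1.smul hr, h2.smul hr, ((auxPsi n k).map_smul r (G₁, G₂)).symm⟩

lemma auxCone_convex (n k : ℕ) : Convex ℝ (auxCone n k) := by
  intro v hv w hw r s hr hs _
  obtain ⟨G₁, G₂, h1, h2, h3⟩ := auxCone_smul hv hr
  obtain ⟨H₁, H₂, h1', h2', h3'⟩ := auxCone_smul hw hs
  refine ⟨G₁ + H₁, G₂ + H₂, h1.add h1', h2.add h2', ?_⟩
  rw [h3, h3']
  exact ((auxPsi n k).map_add (G₁, G₂) (H₁, H₂)).symm

lemma auxCone_closed (n k : ℕ) : IsClosed (auxCone n k) := by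
  let sq : ((Fin n × Fin (k+1) → Fin n × Fin (k+1) → ℝ) × (Fin n × Fin k → Fin n × Fin k → ℝ)) →
    ((Fin n × Fin (k+1) → Fin n × Fin (k+1) → ℝ) × (Fin n × Fin k → Fin n × Fin k → ℝ)) :=
    fun g => ((Matrix.of g.1)ᵀ * (Matrix.of g.1), (Matrix.of g.2)ᵀ * (Matrix.of g.2))
  have hsq : Continuous sq := by
    refine Continuous.prodMk ?_ ?_
    · refine continuous_pi fun p => continuous_pi fun q => ?_
      simp only [Matrix.mul_apply, Matrix.transpose_apply, Matrix.of_apply]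
      fun_prop
    · refine continuous_pi fun p => continuous_pi fun q => ?_
      simp only [Matrix.mul_apply, Matrix.transpose_apply, Matrix.of_apply]
      fun_prop
  have hr : auxCone n k = Set.range (fun g => auxPsi n k (sq g)) := by
    ext v
    constructor
    · rintro ⟨G₁, G₂, h1, h2, rfl⟩
      obtain ⟨A, rfl⟩ := aux_fac h1
      obtain ⟨B, rfl⟩ := aux_fac h2
      exact ⟨(A, B), rfl⟩
    · rintro ⟨g, rfl⟩
      exact ⟨_, _, Matrix.posSemidef_conjTranspose_mul_self (Matrix.of g.1),
        Matrix.posSemidef_conjTranspose_mul_self (Matrix.of g.2), rfl⟩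
  rw [hr]
  refine aux_closed _ ((LinearMap.continuous_of_finiteDimensional (auxPsi n k)).comp hsq) ?_ ?_
  · intro r g
    rw [← LinearMap.map_smul]
    congr 1
    refine Prod.ext ?_ ?_
    · ext p q
      simp only [sq, Matrix.mul_apply, Matrix.transpose_apply, Matrix.of_apply, Prod.smul_fst,
        Pi.smul_apply, smul_eq_mul]
      change _ = r ^ 2 * ((Matrix.of g.1)ᵀ * Matrix.of g.1) p q
      rw [Matrix.mul_apply, Finset.mul_sum]
      simp only [Matrix.transpose_apply, Matrix.of_apply]
      exact Finset.sum_congr rfl fun _ _ => by ring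
    · ext p q
      simp only [sq, Matrix.mul_apply, Matrix.transpose_apply, Matrix.of_apply, Prod.smul_snd,
        Pi.smul_apply, smul_eq_mul]
      change _ = r ^ 2 * ((Matrix.of g.2)ᵀ * Matrix.of g.2) p q
      rw [Matrix.mul_apply, Finset.mul_sum]
      simp only [Matrix.transpose_apply, Matrix.of_apply]
      exact Finset.sum_congr rfl fun _ _ => by ring
  · intro g hg
    have h := auxSq_zero (Matrix.of g.1) (Matrix.of g.2) (fun a => by
      refine auxCoeff_inj (auxTot_deg _ _ _ _) (q := 0) (by simp) fun m => ?_
      exact congrFun (congrFun (congrFun hg a) a) m)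
    exact Prod.ext h.1 h.2

/-- Restriction of a functional to the entry `(a, b)`. -/
noncomputable def auxEll {n N : ℕ} (f : (Fin n → Fin n → Fin N → ℝ) →ₗ[ℝ] ℝ) (a b : Fin n) :
    Polynomial ℝ →ₗ[ℝ] ℝ where
  toFun p := f (Pi.single a (Pi.single b (fun m => p.coeff m)))
  map_add' p q := by
    rw [← map_add, ← Pi.single_add, ← Pi.single_add]
    simp only [Polynomial.coeff_add]
    rfl
  map_smul' r p := by
    rw [RingHom.id_apply, ← map_smul, ← Pi.single_smul, ← Pi.single_smul]
    simp only [Polynomial.coeff_smul]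
    rfl

lemma auxEll_sum {n N : ℕ} (f : (Fin n → Fin n → Fin N → ℝ) →ₗ[ℝ] ℝ)
    (M : Matrix (Fin n) (Fin n) (Polynomial ℝ)) :
    f (fun a b m => (M a b).coeff m) = ∑ a, ∑ b, auxEll f a b (M a b) := by
  simp only [auxEll, LinearMap.coe_mk, AddHom.coe_mk, ← map_sum]
  congr 1
  ext a b m
  simp [Finset.sum_apply, Pi.single_apply, ite_apply, Finset.sum_ite_eq]

lemma auxGp_ell {n k : ℕ} (l : Fin n → Fin n → Polynomial ℝ →ₗ[ℝ] ℝ) (x : Fin n × Fin k → ℝ)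
    (Q : Polynomial ℝ) :
    ∑ a, ∑ b, l a b (Q * auxGp (vecMulVec x x) a b) =
      ∑ p : Fin n × Fin k, ∑ q : Fin n × Fin k, x p * x q * l p.1 q.1 (Q * X ^ ((p.2:ℕ) + q.2)) := by
  simp only [Fintype.sum_prod_type]
  refine Finset.sum_congr rfl fun a _ => ?_
  rw [Finset.sum_comm]
  refine Finset.sum_congr rfl fun b _ => ?_
  simp only [auxGp, Matrix.of_apply, Finset.mul_sum, map_sum, vecMulVec_apply]
  refine Finset.sum_congr rfl fun i _ => Finset.sum_congr rfl fun j _ => ?_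
  rw [← smul_eq_mul (x (a,i) * x (b,j)), ← map_smul, Polynomial.smul_eq_C_mul]
  congr 1
  ring

lemma auxPsd {ι : Type*} [Fintype ι] (K : ι → ι → ℝ)
    (h : ∀ x : ι → ℝ, 0 ≤ ∑ p, ∑ q, x p * x q * K p q) :
    (Matrix.of fun p q => K p q + K q p).PosSemidef := by
  refine Matrix.PosSemidef.of_dotProduct_mulVec_nonneg ?_ fun x => ?_
  · ext p q
    simp [add_comm]
  · have h1 : star x ⬝ᵥ (Matrix.of fun p q => K p q + K q p) *ᵥ x =
        ∑ p, ∑ q, x p * x q * K p q + ∑ p, ∑ q, x p * x q * K p q := by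
      have hcm : ∑ p, ∑ q, x p * x q * K p q = ∑ p, ∑ q, x q * x p * K q p := Finset.sum_comm
      conv_rhs => arg 2; rw [hcm]
      simp only [dotProduct, mulVec, star_trivial, Matrix.of_apply, Finset.mul_sum,
        ← Finset.sum_add_distrib]
      exact Finset.sum_congr rfl fun p _ => Finset.sum_congr rfl fun q _ => by ring
    rw [h1]
    linarith [h x]

lemma aux_mem {n k : ℕ} (P : Matrix (Fin n) (Fin n) (Polynomial ℝ))
    (hsymm : P.IsSymm) (hdeg : ∀ i j, (P i j).natDegree ≤ 2 * k)
    (hP : ∀ t ∈ Set.Icc (-1 : ℝ) 1, (P.map (Polynomial.eval t)).PosSemidef) :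
    (fun a b (m : Fin (2 * k + 1)) => (P a b).coeff m) ∈ auxCone n k := by
  by_contra hcon
  obtain ⟨F, u, hu, hF⟩ := geometric_hahn_banach_point_closed (auxCone_convex n k)
    (auxCone_closed n k) hcon
  have hzero : (0 : Fin n → Fin n → Fin (2 * k + 1) → ℝ) ∈ auxCone n k :=
    ⟨0, 0, Matrix.PosSemidef.zero, Matrix.PosSemidef.zero, ((auxPsi n k).map_zero).symm⟩
  have hu0 : u < 0 := by simpa using hF 0 hzero
  have hpos : ∀ v ∈ auxCone n k, 0 ≤ F v := by
    intro v hv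
    by_contra hneg
    push Not at hneg
    have h1 := hF _ (auxCone_smul hv (r := u / F v) (div_nonneg_of_nonpos hu0.le hneg.le))
    rw [map_smul, smul_eq_mul, div_mul_cancel₀ _ hneg.ne] at h1
    exact lt_irrefl _ h1
  set f : (Fin n → Fin n → Fin (2 * k + 1) → ℝ) →ₗ[ℝ] ℝ := F.toLinearMap with hf
  let l := auxEll f
  have hcone : ∀ (G₁ : Matrix (Fin n × Fin (k+1)) (Fin n × Fin (k+1)) ℝ)
      (G₂ : Matrix (Fin n × Fin k) (Fin n × Fin k) ℝ), G₁.PosSemidef → G₂.PosSemidef →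
      0 ≤ ∑ a, ∑ b, l a b (auxGp G₁ a b + (1 - X ^ 2) * auxGp G₂ a b) := by
    intro G₁ G₂ h1 h2
    have h3 := hpos _ ⟨G₁, G₂, h1, h2, rfl⟩
    have h4 := auxEll_sum f (Matrix.of fun a b => auxGp G₁ a b + (1 - X ^ 2) * auxGp G₂ a b)
    simp only [Matrix.of_apply] at h4
    rw [← h4]
    exact h3
  have hgp0 : ∀ (k' : ℕ) a b, auxGp (0 : Matrix (Fin n × Fin k') (Fin n × Fin k') ℝ) a b = 0 := by
    intro k' a b; simp [auxGp]
  have hvv : ∀ {ι : Type} [Fintype ι] (x : ι → ℝ), (vecMulVec x x).PosSemidef := by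
    intro ι _ x
    simpa using Matrix.posSemidef_vecMulVec_self_star x
  have hK1 := auxPsd (fun p q : Fin n × Fin (k+1) => l p.1 q.1 (X ^ ((p.2:ℕ) + q.2))) (by
    intro x
    have h1 := hcone (vecMulVec x x) 0 (hvv x) Matrix.PosSemidef.zero
    have h2 := auxGp_ell l x 1
    simp only [one_mul] at h2
    simp only [hgp0, mul_zero, add_zero] at h1
    rwa [h2] at h1)
  have hK2 := auxPsd (fun p q : Fin n × Fin k => l p.1 q.1 ((1 - X ^ 2) * X ^ ((p.2:ℕ) + q.2))) (by
    intro x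
    have h1 := hcone 0 (vecMulVec x x) Matrix.PosSemidef.zero (hvv x)
    have h2 := auxGp_ell l x (1 - X ^ 2)
    simp only [hgp0, zero_add] at h1
    rwa [h2] at h1)
  let c : Fin n → Fin n → ℕ → ℝ := fun a b m => l a b (X ^ m) + l b a (X ^ m)
  obtain ⟨lam, y, hlam, hc⟩ := aux_dual (k := k) c (fun a b m => add_comm _ _)
    (by
      convert hK1 using 1
      ext p q
      simp only [c, Matrix.of_apply]
      rw [add_comm (q.2:ℕ)])
    (by
      convert hK2 using 1
      ext p q
      simp only [c, Matrix.of_apply]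
      rw [add_comm (q.2:ℕ), sub_mul, one_mul, ← pow_add, map_sub, map_sub,
        add_comm 2 ((p.2:ℕ) + q.2)]
      ring)
  have hlP : ∀ a b, ∀ L : Polynomial ℝ →ₗ[ℝ] ℝ,
      L (P a b) = ∑ m ∈ Finset.range (2 * k + 1), (P a b).coeff m * L (X ^ m) := by
    intro a b L
    conv_lhs => rw [(P a b).as_sum_range_C_mul_X_pow' (Nat.lt_succ_of_le (hdeg a b))]
    rw [map_sum]
    refine Finset.sum_congr rfl fun m _ => ?_
    rw [← Polynomial.smul_eq_C_mul, map_smul, smul_eq_mul]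
  have hval : F (fun a b m => (P a b).coeff m) = ∑ a, ∑ b, l a b (P a b) := auxEll_sum f P
  have h2 : 2 * ∑ a, ∑ b, l a b (P a b) =
      ∑ s, ∑ a, ∑ b, y a s * (P a b).eval (lam s) * y b s := by
    have h3 : ∑ a, ∑ b, l a b (P a b) = ∑ a, ∑ b, l b a (P a b) := by
      rw [Finset.sum_comm]
      refine Finset.sum_congr rfl fun a _ => Finset.sum_congr rfl fun b _ => ?_
      rw [hsymm.apply]
    rw [two_mul]
    nth_rw 2 [h3]
    rw [← Finset.sum_add_distrib]
    rw [Finset.sum_comm (s := Finset.univ (α := Fin n × Fin (k+1)))]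
    refine Finset.sum_congr rfl fun a _ => ?_
    rw [← Finset.sum_add_distrib, Finset.sum_comm (s := Finset.univ (α := Fin n × Fin (k+1)))]
    refine Finset.sum_congr rfl fun b _ => ?_
    rw [hlP, hlP, ← Finset.sum_add_distrib]
    simp only [Polynomial.eval_eq_sum_range' (Nat.lt_succ_of_le (hdeg a b)), Finset.mul_sum,
      Finset.sum_mul]
    rw [Finset.sum_comm]
    refine Finset.sum_congr rfl fun m hm => ?_
    rw [← mul_add]
    change (P a b).coeff m * c a b m = _
    rw [hc a b m (Nat.lt_succ_iff.1 (Finset.mem_range.1 hm)), Finset.mul_sum]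
    exact Finset.sum_congr rfl fun _ _ => by ring
  have h3 : 0 ≤ ∑ s, ∑ a, ∑ b, y a s * (P a b).eval (lam s) * y b s := by
    refine Finset.sum_nonneg fun s _ => ?_
    have h4 := (hP _ (hlam s)).dotProduct_mulVec_nonneg (fun a => y a s)
    simp only [dotProduct, mulVec, star_trivial, Matrix.map_apply, Finset.mul_sum] at h4
    simpa only [mul_assoc] using h4
  linarith

lemma auxSos_eval {n : ℕ} {Y : Matrix (Fin n) (Fin n) (Polynomial ℝ)} (h : IsSosMatrix Y) (t : ℝ) :
    (Y.map (Polynomial.eval t)).PosSemidef := by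
  obtain ⟨r, A, rfl⟩ := h
  have : (Aᵀ * A).map (Polynomial.eval t) =
      (A.map (Polynomial.eval t))ᴴ * A.map (Polynomial.eval t) := by
    ext a b
    simp [Matrix.mul_apply, Polynomial.eval_finsetSum]
  rw [this]
  exact Matrix.posSemidef_conjTranspose_mul_self _

/-- for a symmetric univariate polynomial matrix `P(t)` of even degree at most
`d`, `P(t) ⪰ 0` for all `t ∈ [-1,1]` if and only if there exist sos-matrices `X₁(t)` of
degree at most `d` and `X₂(t)` of degree at most `d-2` such that
`P(t) = X₁(t) + (1-t²)·X₂(t)` identically. -/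
theorem stmt_4 {n d : ℕ} (hd : Even d) (P : Matrix (Fin n) (Fin n) (Polynomial ℝ))
    (hsymm : P.IsSymm) (hdeg : ∀ i j, (P i j).natDegree ≤ d) :
    (∀ t ∈ Set.Icc (-1 : ℝ) 1, (P.map (Polynomial.eval t)).PosSemidef) ↔
    ∃ X₁ X₂ : Matrix (Fin n) (Fin n) (Polynomial ℝ),
      IsSosMatrix X₁ ∧ IsSosMatrix X₂ ∧
      (∀ i j, (X₁ i j).natDegree ≤ d) ∧ (∀ i j, (X₂ i j).natDegree ≤ d - 2) ∧
      P = X₁ + (1 - (Polynomial.X : Polynomial ℝ) ^ 2) • X₂ := by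
  constructor
  · intro hP
    obtain ⟨k, rfl⟩ := hd
    rw [← two_mul] at hdeg ⊢
    obtain ⟨G₁, G₂, h1, h2, h3⟩ := aux_mem P hsymm hdeg hP
    refine ⟨auxGp G₁, auxGp G₂, auxGp_sos h1, auxGp_sos h2,
      fun i j => (auxGp_deg _ _ _).trans (by omega), fun i j => auxGp_deg _ _ _, ?_⟩
    ext1 a b
    refine auxCoeff_inj (hdeg a b) (auxTot_deg G₁ G₂ a b) fun m => ?_
    exact congrFun (congrFun (congrFun h3 a) b) m
  · rintro ⟨X₁, X₂, h1, h2, -, -, rfl⟩ t ht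
    have ht2 : 0 ≤ 1 - t ^ 2 := by nlinarith [ht.1, ht.2]
    have : (X₁ + (1 - (Polynomial.X : Polynomial ℝ) ^ 2) • X₂).map (Polynomial.eval t) =
        X₁.map (Polynomial.eval t) + (1 - t ^ 2) • X₂.map (Polynomial.eval t) := by
      ext a b
      simp
    rw [this]
    exact (auxSos_eval h1 t).add ((auxSos_eval h2 t).smul ht2)
end

section
/- Let φ(t) = (1, t, t², …, t⁸)ᵀ ∈ ℝ⁹ and let Ω = {x ∈ ℝ⁹ : (xᵀφ(t))² ≤ 1 for all t ∈ [-1,1]}. Then Ω is a generalized ellipsoid of degree 16 (defined by the polynomial matrix P(t) = φ(t)φ(t)ᵀ, which satisfies the psd condition and the kernel condition), and Ω is not SOCP-representable. -/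
open Matrix Polynomial

/-- The `(n+1)`-dimensional second-order cone
`L_{n+1} = {x ∈ ℝ^{n+1} : √(x₁² + ⋯ + x_n²) ≤ x_{n+1}}`. -/
noncomputable def secondOrderCone (n : ℕ) : Set (Fin (n + 1) → ℝ) :=
  {x | Real.sqrt (∑ i : Fin n, x i.castSucc ^ 2) ≤ x (Fin.last n)}

/-- A set `Ω ⊆ ℝⁿ` is SOCP-representable if `Ω = {x : ∃ u, Ax + Bu + b ∈ K}` where `K` is a
finite Cartesian product of second-order cones (the product cone is encoded blockwise). -/
def SOCPRepresentable {n : ℕ} (Ω : Set (Fin n → ℝ)) : Prop :=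
  ∃ (k p : ℕ) (dims : Fin p → ℕ)
    (A : (i : Fin p) → Matrix (Fin (dims i + 1)) (Fin n) ℝ)
    (B : (i : Fin p) → Matrix (Fin (dims i + 1)) (Fin k) ℝ)
    (b : (i : Fin p) → Fin (dims i + 1) → ℝ),
    Ω = {x | ∃ u : Fin k → ℝ, ∀ i : Fin p,
      ((A i).mulVec x + (B i).mulVec u + b i) ∈ secondOrderCone (dims i)}

/-- The polynomial matrix `P(t) = φ(t)φ(t)ᵀ` where `φ(t) = (1, t, …, t⁸)ᵀ`,
i.e. `P(t)ᵢⱼ = t^{i+j}`. -/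
noncomputable def Pphi : Matrix (Fin 9) (Fin 9) (Polynomial ℝ) :=
  Matrix.of fun i j => (Polynomial.X : Polynomial ℝ) ^ ((i : ℕ) + (j : ℕ))

/-- The set `Ω = {x ∈ ℝ⁹ : (xᵀφ(t))² ≤ 1 for all t ∈ [-1,1]}`. -/
def OmegaSet : Set (Fin 9 → ℝ) :=
  {x | ∀ t ∈ Set.Icc (-1 : ℝ) 1, (∑ i : Fin 9, x i * t ^ (i : ℕ)) ^ 2 ≤ 1}


/-- The first `n` coordinates as a Euclidean vector. -/
noncomputable def socTail {n : ℕ} (x : Fin (n + 1) → ℝ) : EuclideanSpace ℝ (Fin n) :=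
  WithLp.toLp 2 (fun i => x i.castSucc)

lemma mem_soc {n : ℕ} (x : Fin (n + 1) → ℝ) :
    x ∈ secondOrderCone n ↔ ‖socTail x‖ ≤ x (Fin.last n) := by
  simp [secondOrderCone, socTail, EuclideanSpace.norm_eq]

lemma socTail_add {n : ℕ} (x y : Fin (n + 1) → ℝ) : socTail (x + y) = socTail x + socTail y := by
  ext i; simp [socTail]

lemma socTail_sub {n : ℕ} (x y : Fin (n + 1) → ℝ) : socTail (x - y) = socTail x - socTail y := by
  ext i; simp [socTail]

lemma socTail_smul {n : ℕ} (c : ℝ) (x : Fin (n + 1) → ℝ) :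
    socTail (c • x) = c • socTail x := by
  ext i; simp [socTail]

lemma soc_ext {n : ℕ} {x y : Fin (n + 1) → ℝ} (h : socTail x = socTail y)
    (h' : x (Fin.last n) = y (Fin.last n)) : x = y := by
  funext i
  refine Fin.lastCases h' (fun j => ?_) i
  have := congrArg (fun v : EuclideanSpace ℝ (Fin n) => v j) h
  simpa [socTail] using this

lemma soc_zero {n : ℕ} : (0 : Fin (n + 1) → ℝ) ∈ secondOrderCone n := by
  simp [secondOrderCone]

lemma soc_add {n : ℕ} {x y : Fin (n + 1) → ℝ} (hx : x ∈ secondOrderCone n)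
    (hy : y ∈ secondOrderCone n) : x + y ∈ secondOrderCone n := by
  rw [mem_soc] at *
  rw [socTail_add, Pi.add_apply]
  exact (norm_add_le _ _).trans (add_le_add hx hy)

lemma soc_smul {n : ℕ} {x : Fin (n + 1) → ℝ} {c : ℝ} (hc : 0 ≤ c)
    (hx : x ∈ secondOrderCone n) : c • x ∈ secondOrderCone n := by
  rw [mem_soc] at *
  rw [socTail_smul, norm_smul, Real.norm_of_nonneg hc, Pi.smul_apply, smul_eq_mul]
  exact mul_le_mul_of_nonneg_left hx hc

lemma soc_sum {n : ℕ} {ι : Type*} (s : Finset ι) (f : ι → Fin (n + 1) → ℝ)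
    (hf : ∀ i ∈ s, f i ∈ secondOrderCone n) : ∑ i ∈ s, f i ∈ secondOrderCone n :=
  Finset.sum_induction f (· ∈ secondOrderCone n) (fun _ _ => soc_add) soc_zero hf

/-- `y` lies in the minimal face of `z` (for `y`, `z` in the cone). -/
def FaceLe {n : ℕ} (y z : Fin (n + 1) → ℝ) : Prop :=
  ∃ c : ℝ, 0 < c ∧ z - c • y ∈ secondOrderCone n

lemma FaceLe.trans {n : ℕ} {y z w : Fin (n + 1) → ℝ} (h : FaceLe y z) (h' : FaceLe z w) :
    FaceLe y w := by
  obtain ⟨c, hc, h⟩ := h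
  obtain ⟨d, hd, h'⟩ := h'
  refine ⟨d * c, mul_pos hd hc, ?_⟩
  have := soc_add h' (soc_smul hd.le h)
  convert this using 1
  rw [smul_sub, smul_smul]; abel

lemma faceLe_mono {n : ℕ} {y z : Fin (n + 1) → ℝ} (hz : z ∈ secondOrderCone n) {c d : ℝ}
    (hc : 0 < c) (h : z - c • y ∈ secondOrderCone n) (hd : 0 ≤ d) (hdc : d ≤ c) :
    z - d • y ∈ secondOrderCone n := by
  have h1 : 0 ≤ d / c := by positivity
  have h2 : d / c ≤ 1 := (div_le_one hc).2 hdc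
  have := soc_add (soc_smul (sub_nonneg.2 h2) hz) (soc_smul h1 h)
  convert this using 1
  have : d = d / c * c := by field_simp
  conv_lhs => rw [this]
  rw [smul_sub, smul_smul, sub_smul, one_smul]; abel

/-- Faces of a second-order cone: zero, a ray, or everything. -/
lemma face_trichotomy {n : ℕ} {y z : Fin (n + 1) → ℝ} (hy : y ∈ secondOrderCone n)
    (hz : z ∈ secondOrderCone n) (h : FaceLe y z) :
    (∀ w, FaceLe w z) ∨ y = 0 ∨ FaceLe z y := by
  rw [mem_soc] at hz
  rcases hz.lt_or_eq with hlt | heq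
  · left
    intro w
    set δ := z (Fin.last n) - ‖socTail z‖ with hδ
    have hδ0 : 0 < δ := sub_pos.2 hlt
    set M := 1 + ‖socTail w‖ + |w (Fin.last n)| with hM
    have hM0 : 0 < M := by positivity
    have hc : 0 < δ / M := by positivity
    refine ⟨δ / M, hc, ?_⟩
    rw [mem_soc, socTail_sub, socTail_smul, Pi.sub_apply, Pi.smul_apply, smul_eq_mul]
    have h1 := norm_sub_le (socTail z) ((δ / M) • socTail w)
    rw [norm_smul, Real.norm_of_nonneg hc.le] at h1
    have h2 : δ / M * M = δ := by field_simp
    have h3 : δ / M * w (Fin.last n) ≤ δ / M * |w (Fin.last n)| :=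
      mul_le_mul_of_nonneg_left (le_abs_self _) hc.le
    have h4 : δ / M * M = δ / M + δ / M * ‖socTail w‖ + δ / M * |w (Fin.last n)| := by
      rw [hM]; ring
    linarith
  · right
    obtain ⟨c, hc, h⟩ := h
    rw [mem_soc, socTail_sub, socTail_smul, Pi.sub_apply, Pi.smul_apply, smul_eq_mul] at h
    have hy' := hy
    rw [mem_soc] at hy'
    by_cases hy0 : socTail y = 0
    · -- then the last coordinate vanishes
      rw [hy0, smul_zero, sub_zero, heq] at h
      rw [hy0, norm_zero] at hy'
      have : y (Fin.last n) = 0 := by nlinarith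
      left
      refine soc_ext ?_ (by simpa using this)
      rw [hy0]; ext i; simp [socTail]
    · right
      have e1 : ‖c • socTail y‖ = c * ‖socTail y‖ := by
        rw [norm_smul, Real.norm_of_nonneg hc.le]
      have e2 : c * ‖socTail y‖ ≤ c * y (Fin.last n) := mul_le_mul_of_nonneg_left hy' hc.le
      have e3 := norm_add_le (socTail z - c • socTail y) (c • socTail y)
      rw [sub_add_cancel] at e3
      have e4 : ‖(socTail z - c • socTail y) + c • socTail y‖
          = ‖socTail z - c • socTail y‖ + ‖c • socTail y‖ := by
        rw [sub_add_cancel]; linarith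
      have hyl : ‖socTail y‖ = y (Fin.last n) := by
        have : c * ‖socTail y‖ = c * y (Fin.last n) := by linarith
        exact mul_left_cancel₀ hc.ne' this
      have hray : SameRay ℝ (socTail z - c • socTail y) (c • socTail y) :=
        sameRay_iff_norm_add.2 e4
      have hne : c • socTail y ≠ 0 := smul_ne_zero hc.ne' hy0
      obtain ⟨r, hr, hr'⟩ := hray.exists_nonneg_right hne
      have hz1 : socTail z = ((1 + r) * c) • socTail y := by
        have : socTail z = r • c • socTail y + c • socTail y := by rw [← hr']; abel
        rw [this, smul_smul, ← add_smul]; congr 1; ring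
      have hk : 0 < (1 + r) * c := by positivity
      have hz2 : z = ((1 + r) * c) • y := by
        refine soc_ext (by rw [hz1, socTail_smul]) ?_
        rw [← heq, hz1, norm_smul, Real.norm_of_nonneg hk.le, hyl]; rfl
      refine ⟨((1 + r) * c)⁻¹, by positivity, ?_⟩
      rw [hz2, smul_smul, inv_mul_cancel₀ hk.ne', one_smul, sub_self]
      exact soc_zero

lemma pick_triple (p M : ℕ) (hM : M = Nat.card (Set (Fin p)))
    (C : Fin (M * (M + 1) + 1) → Set (Fin p))
    (D : Fin (M * (M + 1) + 1) → Fin (M * (M + 1) + 1) → Set (Fin p)) :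
    ∃ s t r, r ≠ s ∧ r ≠ t ∧ C s = C r ∧ D s t = D s r := by
  classical
  have hM' : M = Fintype.card (Set (Fin p)) := by rw [hM, Nat.card_eq_fintype_card]
  obtain ⟨c, hc⟩ := Fintype.exists_lt_card_fiber_of_mul_lt_card (f := C) (n := M + 1)
    (by rw [Fintype.card_fin, ← hM']; omega)
  set F := Finset.univ.filter (fun x => C x = c) with hF
  obtain ⟨s, hs⟩ : F.Nonempty := Finset.card_pos.1 (by omega)
  have hcard : (Finset.univ : Finset (Set (Fin p))).card < (F.erase s).card := by
    rw [Finset.card_erase_of_mem hs, Finset.card_univ, ← hM']; omega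
  obtain ⟨t, ht, r, hr, htr, h⟩ := Finset.exists_ne_map_eq_of_card_lt_of_maps_to hcard
    (f := D s) (fun _ _ => by simp)
  refine ⟨s, t, r, Finset.ne_of_mem_erase hr, htr.symm, ?_, h⟩
  have h1 := (Finset.mem_filter.1 hs).2
  have h2 := (Finset.mem_filter.1 (Finset.mem_of_mem_erase hr)).2
  rw [h1, h2]

/-- Coefficients of `1 - (T - s)² (T - t)² / 8`. -/
noncomputable def qvec (s t : ℝ) : Fin 9 → ℝ :=
  ![1 - (s * t) ^ 2 / 8, (s + t) * (s * t) / 4, -((s + t) ^ 2 + 2 * (s * t)) / 8,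
    (s + t) / 4, -1 / 8, 0, 0, 0, 0]

lemma qvec_comm (s t : ℝ) : qvec s t = qvec t s := by
  simp only [qvec, mul_comm s t, add_comm s t]

lemma qvec_eval (s t r : ℝ) :
    ∑ i : Fin 9, qvec s t i * r ^ (i : ℕ) = 1 - (r - s) ^ 2 * (r - t) ^ 2 / 8 := by
  simp [Fin.sum_univ_succ, qvec]
  ring

lemma qvec_mem {s t : ℝ} (hs : s ∈ Set.Icc (-1 : ℝ) 1) (ht : t ∈ Set.Icc (-1 : ℝ) 1) :
    qvec s t ∈ OmegaSet := by
  intro r hr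
  rw [qvec_eval]
  obtain ⟨h1, h2⟩ := hs
  obtain ⟨h3, h4⟩ := ht
  obtain ⟨h5, h6⟩ := hr
  have a1 : (r - s) ^ 2 ≤ 4 := by nlinarith
  have a2 : (r - t) ^ 2 ≤ 4 := by nlinarith
  have a3 : 0 ≤ (r - s) ^ 2 * (r - t) ^ 2 := by positivity
  have a4 : (r - s) ^ 2 * (r - t) ^ 2 ≤ 4 * 4 :=
    mul_le_mul a1 a2 (sq_nonneg _) (by norm_num)
  rw [sq_le_one_iff_abs_le_one, abs_le]
  constructor <;> linarith

theorem not_socp : ¬ SOCPRepresentable OmegaSet := by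
  rintro ⟨k, p, dims, A, B, b, hΩ⟩
  have hlift : ∀ x : Fin 9 → ℝ, ∃ u : Fin k → ℝ, x ∈ OmegaSet → ∀ i : Fin p,
      ((A i).mulVec x + (B i).mulVec u + b i) ∈ secondOrderCone (dims i) := by
    intro x
    by_cases hx : x ∈ OmegaSet
    · have hx' := hx
      rw [hΩ] at hx'
      obtain ⟨u, hu⟩ := hx'
      exact ⟨u, fun _ => hu⟩
    · exact ⟨0, fun h => absurd h hx⟩
  choose g hg using hlift
  obtain ⟨M, hM⟩ : ∃ M, M = Nat.card (Set (Fin p)) := ⟨_, rfl⟩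
  set N := M * (M + 1) + 1 with hN
  have hN0 : (0 : ℝ) < N := by rw [hN]; positivity
  let τ : Fin N → ℝ := fun a => (a : ℕ) / (N : ℝ)
  have hτ : ∀ a, τ a ∈ Set.Icc (-1 : ℝ) 1 := by
    intro a
    have h1 : 0 ≤ τ a := by positivity
    have h2 : τ a ≤ 1 := by
      refine (div_le_one hN0).2 ?_
      exact_mod_cast a.2.le
    exact ⟨by linarith, h2⟩
  have hτinj : ∀ a a', a ≠ a' → τ a - τ a' ≠ 0 := by
    intro a a' h h'
    apply h
    have : (a : ℕ) / (N : ℝ) = (a' : ℕ) / (N : ℝ) := sub_eq_zero.1 h'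
    rw [div_left_inj' hN0.ne'] at this
    exact Fin.ext (by exact_mod_cast this)
  -- lifted points
  let X : Fin N → Fin N → Fin 9 → ℝ := fun a a' => qvec (τ a) (τ a')
  let L : (i : Fin p) → (Fin 9 → ℝ) → (Fin k → ℝ) → (Fin (dims i + 1) → ℝ) :=
    fun i x u => (A i).mulVec x + (B i).mulVec u + b i
  let Y : (i : Fin p) → Fin N → Fin N → (Fin (dims i + 1) → ℝ) :=
    fun i a a' => L i (X a a') (g (X a a'))
  have hY : ∀ i a a', Y i a a' ∈ secondOrderCone (dims i) :=
    fun i a a' => hg _ (qvec_mem (hτ a) (hτ a')) i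
  have hYc : ∀ i a a', Y i a a' = Y i a' a := by
    intro i a a'
    have : X a a' = X a' a := qvec_comm _ _
    simp only [Y, this]
  let ZX : Fin N → Fin 9 → ℝ := fun a => (N : ℝ)⁻¹ • ∑ a', X a a'
  let ZU : Fin N → Fin k → ℝ := fun a => (N : ℝ)⁻¹ • ∑ a', g (X a a')
  let Z : (i : Fin p) → Fin N → (Fin (dims i + 1) → ℝ) := fun i a => L i (ZX a) (ZU a)
  have hZY : ∀ i a, Z i a = (N : ℝ)⁻¹ • ∑ a', Y i a a' := by
    intro i a
    simp only [Z, Y, L, ZX, ZU, Finset.sum_add_distrib, smul_add, Matrix.mulVec_smul]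
    congr 1
    · congr 1
      · congr 1
        exact map_sum (A i).mulVecLin _ _
      · congr 1
        exact map_sum (B i).mulVecLin _ _
    · rw [Finset.sum_const, Finset.card_univ, Fintype.card_fin, ← Nat.cast_smul_eq_nsmul ℝ,
        smul_smul, inv_mul_cancel₀ hN0.ne', one_smul]
  have hZ : ∀ i a, Z i a ∈ secondOrderCone (dims i) := by
    intro i a
    rw [hZY]
    exact soc_smul (by positivity) (soc_sum _ _ (fun a' _ => hY i a a'))
  have hYZ : ∀ i a a', FaceLe (Y i a a') (Z i a) := by
    intro i a a'
    refine ⟨(N : ℝ)⁻¹, by positivity, ?_⟩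
    rw [hZY, ← smul_sub, ← Finset.add_sum_erase _ _ (Finset.mem_univ a'), add_sub_cancel_left]
    exact soc_smul (by positivity) (soc_sum _ _ (fun a' _ => hY i a a'))
  obtain ⟨s, t, r, hrs, hrt, hC, hD⟩ := pick_triple p M hM
    (fun a => {i | ∀ w, FaceLe w (Z i a)}) (fun a a' => {i | FaceLe (Z i a) (Z i a')})
  have hC' : ∀ i, (∀ w, FaceLe w (Z i s)) ↔ (∀ w, FaceLe w (Z i r)) := Set.ext_iff.1 hC
  have hD' : ∀ i, FaceLe (Z i s) (Z i t) ↔ FaceLe (Z i s) (Z i r) := Set.ext_iff.1 hD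
  have key : ∀ i, FaceLe (Y i s t) (Z i r) := by
    intro i
    rcases face_trichotomy (hY i s t) (hZ i s) (hYZ i s t) with h | h | h
    · exact (hC' i).1 h _
    · refine ⟨1, one_pos, ?_⟩
      rw [h, smul_zero, sub_zero]
      exact hZ i r
    · have h1 : FaceLe (Y i s t) (Z i t) := by rw [hYc]; exact hYZ i t s
      exact (hYZ i s t).trans ((hD' i).1 (h.trans h1))
  choose c hc0 hc using key
  obtain ⟨ε, hε, hεc⟩ : ∃ ε : ℝ, 0 < ε ∧ ∀ i, ε ≤ c i := by
    rcases isEmpty_or_nonempty (Fin p) with hp | hp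
    · exact ⟨1, one_pos, fun i => (hp.false i).elim⟩
    · obtain ⟨i, hi⟩ := Finite.exists_min c
      exact ⟨c i, hc0 i, hi⟩
  have hw : (1 + ε) • ZX r - ε • X s t ∈ OmegaSet := by
    rw [hΩ]
    refine ⟨(1 + ε) • ZU r - ε • g (X s t), fun i => ?_⟩
    have h1 := faceLe_mono (hZ i r) (hc0 i) (hc i) hε.le (hεc i)
    have h2 := soc_add h1 (soc_smul hε.le (hZ i r))
    convert h2 using 1
    simp only [Z, Y, L, Matrix.mulVec_sub, Matrix.mulVec_smul]
    module
  have hv := hw (τ r) (hτ r)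
  have e1 : ∑ i : Fin 9, ZX r i * τ r ^ (i : ℕ) = 1 := by
    have h0 : ∀ a', ∑ i : Fin 9, X r a' i * τ r ^ (i : ℕ) = 1 := by
      intro a'
      simp only [X, qvec_eval]; ring
    simp only [ZX, Pi.smul_apply, Finset.sum_apply, smul_eq_mul, mul_assoc, Finset.sum_mul]
    rw [← Finset.mul_sum, Finset.sum_comm]
    simp only [h0]
    rw [Finset.sum_const, Finset.card_univ, Fintype.card_fin, nsmul_eq_mul, mul_one,
      inv_mul_cancel₀ hN0.ne']
  have e2 : ∑ i : Fin 9, ((1 + ε) • ZX r - ε • X s t) i * τ r ^ (i : ℕ)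
      = (1 + ε) * 1 - ε * (1 - (τ r - τ s) ^ 2 * (τ r - τ t) ^ 2 / 8) := by
    have e3 : (1 + ε) * (1 : ℝ) = (1 + ε) * ∑ i : Fin 9, ZX r i * τ r ^ (i : ℕ) := by rw [e1]
    rw [e3, ← qvec_eval, Finset.mul_sum, Finset.mul_sum, ← Finset.sum_sub_distrib]
    refine Finset.sum_congr rfl fun i _ => ?_
    simp only [Pi.sub_apply, Pi.smul_apply, smul_eq_mul, X]; ring
  rw [e2] at hv
  have hq : 0 < (τ r - τ s) ^ 2 * (τ r - τ t) ^ 2 :=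
    mul_pos (sq_pos_of_ne_zero (hτinj _ _ hrs)) (sq_pos_of_ne_zero (hτinj _ _ hrt))
  have hq' := mul_pos hε hq
  have := (abs_le.1 (sq_le_one_iff_abs_le_one _ |>.1 hv)).2
  nlinarith

lemma Pphi_map (t : ℝ) : Pphi.map (Polynomial.eval t)
    = Matrix.vecMulVec (fun i : Fin 9 => t ^ (i : ℕ)) (fun i : Fin 9 => t ^ (i : ℕ)) := by
  ext i j
  simp [Pphi, Matrix.vecMulVec_apply, pow_add]

theorem stmt_8 :
    Pphi.IsSymm ∧
    (∀ i j, (Pphi i j).natDegree ≤ 16) ∧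
    (∀ t ∈ Set.Icc (-1 : ℝ) 1, (Pphi.map (Polynomial.eval t)).PosSemidef) ∧
    (∀ x : Fin 9 → ℝ,
      (∀ t ∈ Set.Icc (-1 : ℝ) 1, (Pphi.map (Polynomial.eval t)).mulVec x = 0) → x = 0) ∧
    OmegaSet =
      {x : Fin 9 → ℝ | ∀ t ∈ Set.Icc (-1 : ℝ) 1,
        x ⬝ᵥ (Pphi.map (Polynomial.eval t)).mulVec x ≤ 1} ∧
    ¬ SOCPRepresentable OmegaSet := by
  refine ⟨?_, ?_, ?_, ?_, ?_, not_socp⟩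
  · ext i j
    simp [Pphi, add_comm]
  · intro i j
    simp only [Pphi, Matrix.of_apply, Polynomial.natDegree_X_pow]
    omega
  · intro t _
    rw [Pphi_map]
    simpa using Matrix.posSemidef_vecMulVec_self_star (fun i : Fin 9 => t ^ (i : ℕ))
  · intro x hx
    let q : Polynomial ℝ := ∑ i : Fin 9, Polynomial.C (x i) * Polynomial.X ^ (i : ℕ)
    have hq : q = 0 := by
      refine Polynomial.eq_zero_of_infinite_isRoot q
        ((Set.Icc_infinite (show (-1 : ℝ) < 1 by norm_num)).mono ?_)
      intro t ht
      have h := congrFun (hx t ht) 0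
      rw [Pphi_map] at h
      simp only [Matrix.mulVec, dotProduct, Matrix.vecMulVec_apply] at h
      simp only [Set.mem_setOf_eq, Polynomial.IsRoot, q, Polynomial.eval_finset_sum,
        Polynomial.eval_mul, Polynomial.eval_C, Polynomial.eval_pow, Polynomial.eval_X]
      simpa [mul_comm] using h
    funext j
    have h := congrArg (fun f => Polynomial.coeff f (j : ℕ)) hq
    simpa [q, Polynomial.finset_sum_coeff, Polynomial.coeff_C_mul, Polynomial.coeff_X_pow,
      Fin.val_inj] using h
  · ext x
    simp only [OmegaSet, Set.mem_setOf_eq]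
    refine forall₂_congr fun t _ => ?_
    rw [Pphi_map, Matrix.vecMulVec_mulVec]
    simp only [dotProduct, Pi.smul_apply]
    rw [sq]
    simp [← mul_assoc, ← Finset.sum_mul, mul_comm]
end

section
/- Every generalized ellipsoid is SDP-representable: if E ⊆ ℝⁿ is a generalized ellipsoid of degree d centered at the origin, then there exist nonnegative integers k and m₀ and real symmetric m₀×m₀ matrices A₀, A₁, …, A_n, B₁, …, B_k such that E = {x ∈ ℝⁿ : ∃ y ∈ ℝᵏ with A₀ + Σ_{i=1}^n xᵢAᵢ + Σ_{i=1}^k yᵢBᵢ ⪰ 0}. -/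
open Matrix Polynomial

/-- `E ⊆ ℝⁿ` is a generalized ellipsoid of degree `d` (GE-`d`) centered at the origin. -/
def IsGE (n d : ℕ) (E : Set (Fin n → ℝ)) : Prop :=
  ∃ P : Matrix (Fin n) (Fin n) (Polynomial ℝ),
    P.IsSymm ∧
    (∀ i j, (P i j).natDegree ≤ d) ∧
    (∀ t ∈ Set.Icc (-1 : ℝ) 1, (P.map (Polynomial.eval t)).PosSemidef) ∧
    (∀ x : Fin n → ℝ,
      (∀ t ∈ Set.Icc (-1 : ℝ) 1, (P.map (Polynomial.eval t)).mulVec x = 0) → x = 0) ∧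
    E = {x : Fin n → ℝ | ∀ t ∈ Set.Icc (-1 : ℝ) 1,
      x ⬝ᵥ (P.map (Polynomial.eval t)).mulVec x ≤ 1}


/-- Two-squares representation of nonnegative univariate polynomials. -/
theorem sos_aux (N : ℕ) : ∀ p : ℝ[X], p.natDegree ≤ N → (∀ s, 0 ≤ p.eval s) →
    ∃ f g : ℝ[X], p = f ^ 2 + g ^ 2 ∧ 2 * f.natDegree ≤ p.natDegree ∧
      2 * g.natDegree ≤ p.natDegree := by
  induction N using Nat.strong_induction_on with
  | _ N ih =>
  intro p hN hp
  by_cases hd : p.natDegree = 0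
  · obtain ⟨c, rfl⟩ := natDegree_eq_zero.mp hd
    have hc : 0 ≤ c := by simpa using hp 0
    refine ⟨C (Real.sqrt c), 0, ?_, by simp, by simp⟩
    rw [← C_pow, Real.sq_sqrt hc]; simp
  have hp0 : p ≠ 0 := by rintro rfl; simp at hd
  obtain ⟨z, hz⟩ : ∃ z : ℂ, aeval z p = 0 := by
    have : (p.map (algebraMap ℝ ℂ)).degree ≠ 0 := by
      rw [degree_map]; intro h; exact hd (natDegree_eq_zero_iff_degree_le_zero.mpr h.le)
    obtain ⟨z, hz⟩ := Complex.isAlgClosed.exists_root _ this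
    exact ⟨z, by simpa [aeval_def, eval_map] using hz⟩
  by_cases him : z.im = 0
  · -- real root
    set a := z.re
    have hza : z = (a : ℂ) := by apply Complex.ext <;> simp [a, him]
    have hra : p.eval a = 0 := by
      rw [hza] at hz
      have h2 : aeval ((algebraMap ℝ ℂ) a) p = 0 := hz
      rw [aeval_algebraMap_apply] at h2
      simpa [aeval_def] using h2
    have hder : p.derivative.eval a = 0 := by
      have hmin : IsLocalMin (fun s => p.eval s) a :=
        Filter.Eventually.of_forall fun s => by simpa [hra] using hp s
      have := hmin.deriv_eq_zero
      simpa using this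
    obtain ⟨q, hq⟩ := dvd_iff_isRoot.mpr (show p.IsRoot a from hra)
    have hqa : q.eval a = 0 := by
      rw [hq] at hder; simpa [derivative_mul] using hder
    obtain ⟨r, hr⟩ := dvd_iff_isRoot.mpr (show q.IsRoot a from hqa)
    have hpr : p = (X - C a) ^ 2 * r := by rw [hq, hr]; ring
    have hr0 : r ≠ 0 := by rintro rfl; simp at hpr; exact hp0 hpr
    have hdeg : p.natDegree = 2 + r.natDegree := by
      rw [hpr, natDegree_mul (pow_ne_zero _ (X_sub_C_ne_zero a)) hr0]; simp
    have hrne : ∀ s, s ≠ a → 0 ≤ r.eval s := by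
      intro s hs
      have h := hp s
      rw [hpr] at h
      simp only [eval_mul, eval_pow, eval_sub, eval_X, eval_C] at h
      have : 0 < (s - a) ^ 2 := by have := sub_ne_zero.mpr hs; positivity
      exact nonneg_of_mul_nonneg_right h this
    have hrnn : ∀ s, 0 ≤ r.eval s := by
      have hc : IsClosed {s | 0 ≤ r.eval s} := isClosed_le continuous_const r.continuous
      have hD : Dense ({a}ᶜ : Set ℝ) := dense_compl_singleton a
      intro s
      have : closure ({a}ᶜ : Set ℝ) ⊆ {s | 0 ≤ r.eval s} :=
        closure_minimal (fun s hs => hrne s hs) hc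
      exact this (hD s)
    obtain ⟨f, g, h1, h2, h3⟩ := ih (N - 2) (by omega) r (by omega) hrnn
    refine ⟨(X - C a) * f, (X - C a) * g, ?_, ?_, ?_⟩
    · rw [hpr, h1]; ring
    · have := natDegree_mul_le (p := X - C a) (q := f)
      rw [natDegree_X_sub_C] at this; omega
    · have := natDegree_mul_le (p := X - C a) (q := g)
      rw [natDegree_X_sub_C] at this; omega
  · obtain ⟨r, hr⟩ := p.quadratic_dvd_of_aeval_eq_zero_im_ne_zero hz him
    have hquad : (X ^ 2 - C (2 * z.re) * X + C (‖z‖ ^ 2) : ℝ[X])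
        = (X - C z.re) ^ 2 + C z.im ^ 2 := by
      rw [Complex.sq_norm, Complex.normSq_apply]
      simp only [C_add, C_mul, show (C (2:ℝ) : ℝ[X]) = 2 from rfl]; ring
    rw [hquad] at hr
    have hm : ((X - C z.re) ^ 2 + C z.im ^ 2 : ℝ[X]).natDegree = 2 := by
      rw [← C_pow, natDegree_add_C]; simp
    have hr0 : r ≠ 0 := by rintro rfl; simp at hr; exact hp0 hr
    have hm0 : ((X - C z.re) ^ 2 + C z.im ^ 2 : ℝ[X]) ≠ 0 := by
      intro h; rw [h] at hm; simp at hm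
    have hdeg : p.natDegree = 2 + r.natDegree := by
      rw [hr, natDegree_mul hm0 hr0, hm]
    have hrnn : ∀ s, 0 ≤ r.eval s := by
      intro s
      have h := hp s
      rw [hr] at h
      simp only [eval_mul, eval_pow, eval_sub, eval_X, eval_C, eval_add] at h
      have : 0 < (s - z.re) ^ 2 + z.im ^ 2 := by positivity
      exact nonneg_of_mul_nonneg_right h this
    obtain ⟨f, g, h1, h2, h3⟩ := ih (N - 2) (by omega) r (by omega) hrnn
    have e1 : ∀ u : ℝ[X], ((X - C z.re) * u).natDegree ≤ 1 + u.natDegree := fun u => by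
      have := natDegree_mul_le (p := X - C z.re) (q := u)
      rwa [natDegree_X_sub_C] at this
    have e2 : ∀ u : ℝ[X], (C z.im * u).natDegree ≤ u.natDegree := fun u =>
      natDegree_C_mul_le _ _
    refine ⟨(X - C z.re) * f - C z.im * g, (X - C z.re) * g + C z.im * f, ?_, ?_, ?_⟩
    · rw [hr, h1]; ring
    · have := natDegree_sub_le ((X - C z.re) * f) (C z.im * g)
      have := e1 f
      have := e2 g
      omega
    · have := natDegree_add_le ((X - C z.re) * g) (C z.im * f)
      have := e1 g
      have := e2 f
      omega

/-- Homogenization-type substitution: `(1+s²)^d p(2s/(1+s²))`. -/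
noncomputable def subT (d : ℕ) : ℝ[X] →ₗ[ℝ] ℝ[X] where
  toFun p := ∑ k ∈ Finset.range (d + 1), C (p.coeff k) * ((2 * X) ^ k * (1 + X ^ 2) ^ (d - k))
  map_add' p q := by simp [add_mul, Finset.sum_add_distrib]
  map_smul' c p := by simp [Finset.mul_sum, smul_eq_C_mul, mul_assoc]

theorem subT_eval (d : ℕ) (p : ℝ[X]) (hp : p.natDegree ≤ d) (s : ℝ) :
    (subT d p).eval s = (1 + s ^ 2) ^ d * p.eval (2 * s / (1 + s ^ 2)) := by
  rw [eval_eq_sum_range' (Nat.lt_succ_of_le hp), Finset.mul_sum]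
  simp only [subT, LinearMap.coe_mk, AddHom.coe_mk, eval_finsetSum]
  refine Finset.sum_congr rfl fun k hk => ?_
  have hk' : k ≤ d := Nat.lt_succ_iff.mp (Finset.mem_range.mp hk)
  have hpos : (1 + s ^ 2) ≠ 0 := by positivity
  simp only [eval_mul, eval_C, eval_pow, eval_add, eval_one, eval_X, eval_ofNat]
  rw [div_pow, ← Nat.sub_add_cancel hk', pow_add, Nat.add_sub_cancel]
  field_simp

theorem subT_natDegree (d : ℕ) (p : ℝ[X]) : (subT d p).natDegree ≤ 2 * d := by
  simp only [subT, LinearMap.coe_mk, AddHom.coe_mk]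
  refine natDegree_sum_le_of_forall_le _ _ fun k hk => ?_
  have hk' : k ≤ d := Nat.lt_succ_iff.mp (Finset.mem_range.mp hk)
  refine (natDegree_C_mul_le _ _).trans (natDegree_mul_le.trans ?_)
  have h1 : ((2 * X : ℝ[X]) ^ k).natDegree ≤ k * 1 := by
    refine natDegree_pow_le_of_le k ?_
    exact (natDegree_C_mul_le (2:ℝ) X).trans natDegree_X_le
  have h2 : ((1 + X ^ 2 : ℝ[X]) ^ (d - k)).natDegree ≤ (d - k) * 2 := by
    refine natDegree_pow_le_of_le _ ?_
    compute_degree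
  omega

theorem exists_param (t : ℝ) (ht : t ∈ Set.Icc (-1 : ℝ) 1) : ∃ s : ℝ, 2 * s / (1 + s ^ 2) = t := by
  have h : 0 ≤ 1 - t ^ 2 := by nlinarith [ht.1, ht.2]
  have hr := Real.sq_sqrt h
  have hr0 := Real.sqrt_nonneg (1 - t ^ 2)
  set r := Real.sqrt (1 - t ^ 2)
  refine ⟨t / (1 + r), ?_⟩
  have h1 : 1 + r ≠ 0 := by positivity
  have h2 : 1 + (t / (1 + r)) ^ 2 ≠ 0 := by positivity
  rw [div_eq_iff h2]
  field_simp
  linear_combination (-t) * hr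

theorem param_mem (s : ℝ) : 2 * s / (1 + s ^ 2) ∈ Set.Icc (-1 : ℝ) 1 := by
  have h : 0 < 1 + s ^ 2 := by positivity
  rw [Set.mem_Icc, le_div_iff₀ h, div_le_iff₀ h]
  constructor <;> nlinarith [sq_nonneg (s - 1), sq_nonneg (s + 1)]

theorem trace_mul_nonneg' {n : ℕ} {A B : Matrix (Fin n) (Fin n) ℝ} (hA : A.PosSemidef)
    (hB : B.PosSemidef) : 0 ≤ (A * B).trace := by
  obtain ⟨R, rfl⟩ : ∃ R : Matrix (Fin n) (Fin n) ℝ, A = Rᴴ * R := by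
    open scoped MatrixOrder Matrix.Norms.L2Operator in
    exact CStarAlgebra.nonneg_iff_eq_star_mul_self.mp hA.nonneg
  rw [Matrix.mul_assoc, Matrix.trace_mul_comm]
  exact (hB.mul_mul_conjTranspose_same R).trace_nonneg

/-- Spectrahedra in a real vector space. -/
def Spec {W : Type*} [AddCommGroup W] [Module ℝ W] (S : Set W) : Prop :=
  ∃ (m : Type) (_ : Fintype m) (A₀ : Matrix m m ℝ) (L : W →ₗ[ℝ] Matrix m m ℝ),
    A₀.IsSymm ∧ (∀ w, (L w).IsSymm) ∧ S = {w | (A₀ + L w).PosSemidef}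

theorem posSemidef_blocks {m k : Type} [Fintype m] [Fintype k] (A : Matrix m m ℝ)
    (B : Matrix k k ℝ) : (fromBlocks A 0 0 B).PosSemidef ↔ A.PosSemidef ∧ B.PosSemidef := by
  constructor
  · intro h
    exact ⟨h.submatrix Sum.inl, h.submatrix Sum.inr⟩
  · rintro ⟨hA, hB⟩
    refine PosSemidef.of_dotProduct_mulVec_nonneg ?_ fun x => ?_
    · exact IsHermitian.fromBlocks hA.1 (by simp) hB.1
    · have := hA.dotProduct_mulVec_nonneg (x ∘ Sum.inl)
      have := hB.dotProduct_mulVec_nonneg (x ∘ Sum.inr)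
      rw [fromBlocks_mulVec]
      simp only [dotProduct, Fintype.sum_sum_type] at *
      simp at *
      linarith

theorem Spec.inter {W : Type*} [AddCommGroup W] [Module ℝ W] {S T : Set W} (hS : Spec S)
    (hT : Spec T) : Spec (S ∩ T) := by
  obtain ⟨m, _, A, L, hA, hL, rfl⟩ := hS
  obtain ⟨k, _, B, M, hB, hM, rfl⟩ := hT
  refine ⟨m ⊕ k, inferInstance, fromBlocks A 0 0 B,
    { toFun := fun w => fromBlocks (L w) 0 0 (M w)
      map_add' := fun a b => by simp [fromBlocks_add]
      map_smul' := fun c a => by simp [fromBlocks_smul] }, ?_, ?_, ?_⟩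
  · exact hA.fromBlocks (by simp) hB
  · exact fun w => (hL w).fromBlocks (by simp) (hM w)
  · ext w
    simp [fromBlocks_add, posSemidef_blocks]

theorem Spec.nonneg {W : Type*} [AddCommGroup W] [Module ℝ W] {m : Type} [Fintype m]
    (c : m → ℝ) (f : W →ₗ[ℝ] (m → ℝ)) : Spec {w | ∀ j, 0 ≤ c j + f w j} := by
  classical
  refine ⟨m, inferInstance, diagonal c, (diagonalLinearMap m ℝ ℝ) ∘ₗ f, ?_, ?_, ?_⟩
  · exact isSymm_diagonal _
  · exact fun w => isSymm_diagonal _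
  · ext w
    simp [diagonalLinearMap]

theorem Spec.eqzero {W : Type*} [AddCommGroup W] [Module ℝ W] {m : Type} [Fintype m]
    (c : m → ℝ) (f : W →ₗ[ℝ] (m → ℝ)) : Spec {w | ∀ j, c j + f w j = 0} := by
  have := (Spec.nonneg c f).inter (Spec.nonneg (-c) (-f))
  convert this using 1
  ext w
  simp only [Set.mem_ofPred_eq, Set.mem_inter_iff, ← forall_and]
  refine forall_congr' fun j => ?_
  simp only [Pi.neg_apply, LinearMap.neg_apply]
  constructor
  · intro h; constructor <;> linarith
  · rintro ⟨h1, h2⟩; linarith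

theorem Spec.project {n : ℕ} {V : Type*} [AddCommGroup V] [Module ℝ V] [FiniteDimensional ℝ V]
    (S : Set ((Fin n → ℝ) × V)) (hS : Spec S) :
    ∃ (k m₀ : ℕ) (A₀ : Matrix (Fin m₀) (Fin m₀) ℝ)
      (A : Fin n → Matrix (Fin m₀) (Fin m₀) ℝ) (B : Fin k → Matrix (Fin m₀) (Fin m₀) ℝ),
      A₀.IsSymm ∧ (∀ i, (A i).IsSymm) ∧ (∀ i, (B i).IsSymm) ∧
      {x | ∃ v, (x, v) ∈ S} = {x : Fin n → ℝ | ∃ y : Fin k → ℝ,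
        (A₀ + ∑ i : Fin n, x i • A i + ∑ i : Fin k, y i • B i).PosSemidef} := by
  obtain ⟨m, _, A, L, hA, hL, rfl⟩ := hS
  let e := (Fintype.equivFin m).symm
  let b := Module.finBasis ℝ V
  refine ⟨_, Fintype.card m, A.submatrix e e, fun i => (L (Pi.single i 1, 0)).submatrix e e,
    fun i => (L (0, b i)).submatrix e e, hA.submatrix _, fun i => (hL _).submatrix _,
    fun i => (hL _).submatrix _, ?_⟩
  have key : ∀ (x : Fin n → ℝ) (y : Fin (Module.finrank ℝ V) → ℝ),
      (A.submatrix e e + ∑ i, x i • (L (Pi.single i 1, 0)).submatrix e e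
        + ∑ i, y i • (L (0, b i)).submatrix e e)
      = (A + L (x, ∑ i, y i • b i)).submatrix e e := by
    intro x y
    have h1 : ((x, ∑ i, y i • b i) : (Fin n → ℝ) × V)
        = ∑ i, x i • ((Pi.single i 1, 0) : (Fin n → ℝ) × V) + ∑ i, y i • ((0, b i) : (Fin n → ℝ) × V) := by
      ext1
      · simp [Prod.fst_sum, ← pi_eq_sum_univ' x]
      · simp [Prod.snd_sum]
    rw [h1, map_add, map_sum, map_sum]
    simp only [map_smul]
    ext i j
    simp [Matrix.sum_apply, add_assoc]
  ext x
  simp only [Set.mem_ofPred_eq, key, posSemidef_submatrix_equiv]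
  constructor
  · rintro ⟨v, hv⟩
    exact ⟨b.repr v, by rwa [b.sum_repr]⟩
  · rintro ⟨y, hy⟩
    exact ⟨_, hy⟩

/-- The polynomial `⟨P(t), Y⟩` as a linear function of `Y`. -/
noncomputable def pairP {n : ℕ} (P : Matrix (Fin n) (Fin n) ℝ[X]) :
    Matrix (Fin n) (Fin n) ℝ →ₗ[ℝ] ℝ[X] where
  toFun Y := ∑ i, ∑ j, Y j i • P i j
  map_add' Y Z := by simp [add_smul, Finset.sum_add_distrib]
  map_smul' c Y := by simp [Finset.smul_sum, smul_smul]

theorem pairP_eval {n : ℕ} (P : Matrix (Fin n) (Fin n) ℝ[X]) (Y : Matrix (Fin n) (Fin n) ℝ)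
    (t : ℝ) : (pairP P Y).eval t = ((P.map (Polynomial.eval t)) * Y).trace := by
  simp [pairP, eval_finsetSum, trace, mul_apply, mul_comm]

theorem pairP_natDegree {n d : ℕ} (P : Matrix (Fin n) (Fin n) ℝ[X])
    (hP : ∀ i j, (P i j).natDegree ≤ d) (Y : Matrix (Fin n) (Fin n) ℝ) :
    (pairP P Y).natDegree ≤ d := by
  simp only [pairP, LinearMap.coe_mk, AddHom.coe_mk]
  refine natDegree_sum_le_of_forall_le _ _ fun i _ => ?_
  refine natDegree_sum_le_of_forall_le _ _ fun j _ => ?_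
  exact (natDegree_smul_le _ _).trans (hP i j)

/-- The polynomial `v(s)ᵀ Q v(s)`, `v(s) = (1, s, …, s^d)`. -/
noncomputable def gramP (d : ℕ) : Matrix (Fin (d + 1)) (Fin (d + 1)) ℝ →ₗ[ℝ] ℝ[X] where
  toFun Q := ∑ i, ∑ j, Q i j • X ^ (i.val + j.val)
  map_add' Y Z := by simp [add_smul, Finset.sum_add_distrib]
  map_smul' c Y := by simp [Finset.smul_sum, smul_smul]

theorem gramP_eval (d : ℕ) (Q : Matrix (Fin (d + 1)) (Fin (d + 1)) ℝ) (s : ℝ) :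
    (gramP d Q).eval s
      = (fun i : Fin (d + 1) => s ^ i.val) ⬝ᵥ (Q *ᵥ (fun i : Fin (d + 1) => s ^ i.val)) := by
  simp only [gramP, LinearMap.coe_mk, AddHom.coe_mk, eval_finsetSum, dotProduct, mulVec,
    Finset.mul_sum, eval_smul, eval_pow, eval_X, smul_eq_mul]
  refine Finset.sum_congr rfl fun i _ => Finset.sum_congr rfl fun j _ => ?_
  rw [pow_add]; ring

theorem gramP_natDegree (d : ℕ) (Q : Matrix (Fin (d + 1)) (Fin (d + 1)) ℝ) :
    (gramP d Q).natDegree ≤ 2 * d := by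
  simp only [gramP, LinearMap.coe_mk, AddHom.coe_mk]
  refine natDegree_sum_le_of_forall_le _ _ fun i _ => ?_
  refine natDegree_sum_le_of_forall_le _ _ fun j _ => ?_
  refine (natDegree_smul_le _ _).trans ?_
  rw [natDegree_X_pow]
  omega

theorem gramP_sq (d : ℕ) (f : ℝ[X]) (hf : f.natDegree ≤ d) :
    gramP d (vecMulVec (fun i => f.coeff i) (fun i => f.coeff i)) = f ^ 2 := by
  have h : f = ∑ i : Fin (d + 1), C (f.coeff i) * X ^ i.val := by
    conv_lhs => rw [f.as_sum_range_C_mul_X_pow' (Nat.lt_succ_of_le hf)]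
    rw [Finset.sum_range]
  conv_rhs => rw [h, pow_two, Finset.sum_mul_sum]
  simp only [gramP, LinearMap.coe_mk, AddHom.coe_mk]
  refine Finset.sum_congr rfl fun i _ => Finset.sum_congr rfl fun j _ => ?_
  simp only [vecMulVec_apply, smul_eq_C_mul, C_mul, pow_add]
  ring

/-- Symmetrization. -/
def symL (m : Type) : Matrix m m ℝ →ₗ[ℝ] Matrix m m ℝ where
  toFun Q := Q + Qᵀ
  map_add' A B := by simp; abel
  map_smul' c A := by simp

theorem symL_isSymm {m : Type} (Q : Matrix m m ℝ) : (symL m Q).IsSymm := by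
  show (Q + Qᵀ)ᵀ = Q + Qᵀ
  simp [add_comm]

theorem symL_half {m : Type} (Q : Matrix m m ℝ) (hQ : Q.IsSymm) : symL m ((1 / 2 : ℝ) • Q) = Q := by
  show (1 / 2 : ℝ) • Q + ((1 / 2 : ℝ) • Q)ᵀ = Q
  rw [transpose_smul, hQ.eq, ← add_smul]
  norm_num

/-- The block part `[[Y, x], [xᵀ, 0]]`. -/
def blkL (n : ℕ) : (Fin n → ℝ) × Matrix (Fin n) (Fin n) ℝ →ₗ[ℝ]
    Matrix (Fin n ⊕ Unit) (Fin n ⊕ Unit) ℝ where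
  toFun w := fromBlocks (symL _ w.2) (replicateCol Unit w.1) (replicateRow Unit w.1) 0
  map_add' a b := by simp [fromBlocks_add]
  map_smul' c a := by simp [fromBlocks_smul]

theorem blk_psd (n : ℕ) (x : Fin n → ℝ) (X : Matrix (Fin n) (Fin n) ℝ) :
    (fromBlocks 0 0 0 1 + blkL n (x, X)).PosSemidef
      ↔ (symL _ X - vecMulVec x x).PosSemidef := by
  let : Invertible (1 : Matrix Unit Unit ℝ) := invertibleOne
  have := PosDef.fromBlocks₂₂ (symL _ X) (replicateCol Unit x)
    (D := (1 : Matrix Unit Unit ℝ)) PosDef.one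
  simpa [blkL, fromBlocks_add, ← vecMulVec_eq] using this

/-- every generalized ellipsoid is SDP-representable. -/
theorem stmt_9 {n d : ℕ} (E : Set (Fin n → ℝ)) (hE : IsGE n d E) :
    ∃ (k m₀ : ℕ) (A₀ : Matrix (Fin m₀) (Fin m₀) ℝ)
      (A : Fin n → Matrix (Fin m₀) (Fin m₀) ℝ) (B : Fin k → Matrix (Fin m₀) (Fin m₀) ℝ),
      A₀.IsSymm ∧ (∀ i, (A i).IsSymm) ∧ (∀ i, (B i).IsSymm) ∧
      E = {x : Fin n → ℝ | ∃ y : Fin k → ℝ,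
        (A₀ + ∑ i : Fin n, x i • A i + ∑ i : Fin k, y i • B i).PosSemidef} := by
  obtain ⟨P, -, hdeg, hpsd, -, rfl⟩ := hE
  let V := Matrix (Fin n) (Fin n) ℝ × Matrix (Fin (d + 1)) (Fin (d + 1)) ℝ
  let S₁ : Set ((Fin n → ℝ) × V) := {w | (fromBlocks 0 0 0 1 + blkL n (w.1, w.2.1)).PosSemidef}
  let S₂ : Set ((Fin n → ℝ) × V) := {w | (symL _ w.2.2).PosSemidef}
  let S₃ : Set ((Fin n → ℝ) × V) := {w | ∀ j : Fin (2 * d + 1), (subT d 1).coeff j +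
    (-(subT d (pairP P (symL _ w.2.1))).coeff j - (gramP d (symL _ w.2.2)).coeff j) = 0}
  have h₁ : Spec S₁ := by
    refine ⟨Fin n ⊕ Unit, inferInstance, fromBlocks 0 0 0 1,
      blkL n ∘ₗ (LinearMap.prodMap LinearMap.id (LinearMap.fst ℝ _ _)), ?_, ?_, rfl⟩
    · exact IsSymm.fromBlocks (by simp) (by simp) (by simp)
    · intro w
      exact IsSymm.fromBlocks (symL_isSymm _) (by simp) (by simp)
  have h₂ : Spec S₂ := by
    refine ⟨Fin (d + 1), inferInstance, 0,
      symL _ ∘ₗ (LinearMap.snd ℝ _ _) ∘ₗ (LinearMap.snd ℝ _ _), by simp, ?_, ?_⟩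
    · intro w
      exact symL_isSymm _
    · ext w; simp [S₂]
  have h₃ : Spec S₃ := by
    let p₁ : ((Fin n → ℝ) × V) →ₗ[ℝ] Matrix (Fin n) (Fin n) ℝ :=
      (LinearMap.fst ℝ _ _) ∘ₗ (LinearMap.snd ℝ _ _)
    let p₂ : ((Fin n → ℝ) × V) →ₗ[ℝ] Matrix (Fin (d + 1)) (Fin (d + 1)) ℝ :=
      (LinearMap.snd ℝ _ _) ∘ₗ (LinearMap.snd ℝ _ _)
    let F : Fin (2 * d + 1) → (((Fin n → ℝ) × V) →ₗ[ℝ] ℝ) := fun j =>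
      -(lcoeff ℝ j.val ∘ₗ subT d ∘ₗ pairP P ∘ₗ symL _ ∘ₗ p₁)
        - (lcoeff ℝ j.val ∘ₗ gramP d ∘ₗ symL _ ∘ₗ p₂)
    exact Spec.eqzero (fun j : Fin (2 * d + 1) => (subT d 1).coeff j) (LinearMap.pi F)
  have hS₃ : ∀ w, w ∈ S₃ ↔ subT d (1 - pairP P (symL _ w.2.1)) = gramP d (symL _ w.2.2) := by
    intro w
    rw [ext_iff_natDegree_le (subT_natDegree _ _) (gramP_natDegree _ _), map_sub]
    constructor
    · intro h i hi
      have := h ⟨i, by omega⟩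
      simp only [coeff_sub] at this ⊢
      linarith
    · intro h j
      have := h j.val (by omega)
      simp only [coeff_sub] at this ⊢
      linarith
  have hpd : ∀ Y, (1 - pairP P Y).natDegree ≤ d := fun Y =>
    (natDegree_sub_le _ _).trans (by simpa using pairP_natDegree P hdeg Y)
  have hquad : ∀ (M : Matrix (Fin n) (Fin n) ℝ) (x : Fin n → ℝ),
      (M * vecMulVec x x).trace = x ⬝ᵥ M *ᵥ x := by
    intro M x
    rw [mul_vecMulVec, trace_vecMulVec, dotProduct_comm]
  obtain ⟨k, m₀, A₀, A, B, hA₀, hA, hB, heq⟩ := Spec.project _ ((h₁.inter h₂).inter h₃)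
  refine ⟨k, m₀, A₀, A, B, hA₀, hA, hB, ?_⟩
  rw [← heq]
  ext x
  constructor
  · intro hx
    have hsym : (vecMulVec x x).IsSymm := by
      ext i j; simp [vecMulVec_apply, mul_comm]
    have hnn : ∀ s, 0 ≤ (subT d (1 - pairP P (vecMulVec x x))).eval s := by
      intro s
      rw [subT_eval _ _ (hpd _)]
      have := hx _ (param_mem s)
      rw [eval_sub, pairP_eval, hquad, eval_one]
      exact mul_nonneg (by positivity) (by linarith)
    obtain ⟨f, g, hfg, hf, hg⟩ := sos_aux _ _ le_rfl hnn
    have hT := subT_natDegree d (1 - pairP P (vecMulVec x x))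
    let Q : Matrix (Fin (d + 1)) (Fin (d + 1)) ℝ :=
      vecMulVec (fun i : Fin (d + 1) => f.coeff i) (fun i : Fin (d + 1) => f.coeff i)
        + vecMulVec (fun i : Fin (d + 1) => g.coeff i) (fun i : Fin (d + 1) => g.coeff i)
    have hQp : Q.PosSemidef :=
      (posSemidef_vecMulVec_self_star _).add (posSemidef_vecMulVec_self_star _)
    have hQs : Q.IsSymm := by
      ext i j; simp [Q, vecMulVec_apply, mul_comm]
    refine ⟨((1 / 2 : ℝ) • vecMulVec x x, (1 / 2 : ℝ) • Q), ⟨?_, ?_⟩, ?_⟩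
    · show (fromBlocks 0 0 0 1 + blkL n (x, (1 / 2 : ℝ) • vecMulVec x x)).PosSemidef
      rw [blk_psd, symL_half _ hsym, sub_self]
      exact PosSemidef.zero
    · show (symL _ ((1 / 2 : ℝ) • Q)).PosSemidef
      rwa [symL_half _ hQs]
    · rw [hS₃]
      show subT d (1 - pairP P (symL _ ((1 / 2 : ℝ) • vecMulVec x x)))
        = gramP d (symL _ ((1 / 2 : ℝ) • Q))
      rw [symL_half _ hQs, symL_half _ hsym, map_add, gramP_sq _ _ (by omega),
        gramP_sq _ _ (by omega), hfg]
  · rintro ⟨⟨Y, Q⟩, ⟨hY, hQ⟩, hYQ⟩ t ht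
    rw [hS₃] at hYQ
    replace hY := (blk_psd n x Y).mp hY
    replace hQ : (symL _ Q).PosSemidef := hQ
    obtain ⟨s, rfl⟩ := exists_param t ht
    have h1 := congrArg (eval s) hYQ
    rw [subT_eval _ _ (hpd _), gramP_eval, eval_sub, eval_one, pairP_eval] at h1
    have h2 := hQ.dotProduct_mulVec_nonneg (fun i : Fin (d + 1) => s ^ i.val)
    rw [star_trivial] at h2
    rw [← h1] at h2
    have h3 := nonneg_of_mul_nonneg_right h2 (by positivity)
    have h4 := trace_mul_nonneg' (hpsd _ ht) hY
    rw [mul_sub, trace_sub, hquad] at h4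
    dsimp only at h3
    linarith
end

section
/- For every integer m ≥ 2, there exist univariate real polynomials p₁, …, p_m, each of degree at most 2m-3, satisfying: (1) pᵢ(t) ≥ 0 for all t ∈ [-1,1] and all i = 1,…,m; (2) Σ_{i=1}^m pᵢ(t) = 1 for all t ∈ [-1,1]; and (3) for every i = 1,…,m there exists tᵢ ∈ [-1,1] with pᵢ(tᵢ) = 1. -/
open Polynomial

namespace Tour

/-- weights -/
noncomputable def W (N k : ℕ) : ℝ := (if k = N then 0 else 1) + (if k = 0 then 0 else 1)

/-- the tour polynomials -/
noncomputable def P (N k : ℕ) : ℝ[X] :=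
  ∑ a ∈ Finset.range (2 * N), ∑ b ∈ Finset.range (2 * N),
    C (W N k / (2 * N) ^ 2 * Real.cos (((a : ℝ) - b) * (k * Real.pi / N))) *
      Polynomial.Chebyshev.T ℝ ((a : ℤ) - b)

lemma W_pos (N k : ℕ) (hN : 1 ≤ N) : 1 ≤ W N k := by
  unfold W
  split_ifs <;> first | omega | norm_num

lemma W_sum (N : ℕ) (f : ℕ → ℝ) :
    ∑ k : Fin (N + 1), W N k * f k = ∑ k ∈ Finset.range N, (f k + f (k + 1)) := by
  rw [Fin.sum_univ_eq_sum_range (fun k => W N k * f k)]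
  simp only [W, add_mul, Finset.sum_add_distrib]
  congr 1
  · rw [Finset.sum_range_succ]
    simp only [if_true, zero_mul, add_zero]
    refine Finset.sum_congr rfl fun k hk => ?_
    rw [Finset.mem_range] at hk
    rw [if_neg (by omega), one_mul]
  · rw [Finset.sum_range_succ']
    simp

lemma cos_sum (N : ℕ) (x : ℝ) (hs : Real.sin (x / 2) ≠ 0) (hN : Real.sin (N * x) = 0) :
    ∑ k ∈ Finset.range N, (Real.cos (k * x) + Real.cos ((k + 1 : ℕ) * x)) = 0 := by
  have key : ∀ k : ℕ, Real.sin (x / 2) * (Real.cos (k * x) + Real.cos ((k + 1 : ℕ) * x)) =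
      Real.cos (x / 2) * (Real.sin ((k + 1 : ℕ) * x) - Real.sin (k * x)) := by
    intro k
    have h1 : (k : ℝ) * x = (k * x + x / 2) - x / 2 := by ring
    have h2 : ((k + 1 : ℕ) : ℝ) * x = (k * x + x / 2) + x / 2 := by push_cast; ring
    rw [h2]
    generalize hy : (k : ℝ) * x + x / 2 = y at *
    rw [h1, Real.cos_sub, Real.cos_add, Real.sin_sub, Real.sin_add]
    ring
  have h : Real.sin (x / 2) *
      ∑ k ∈ Finset.range N, (Real.cos (k * x) + Real.cos ((k + 1 : ℕ) * x)) = 0 := by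
    rw [Finset.mul_sum, Finset.sum_congr rfl fun k _ => key k, ← Finset.mul_sum,
      Finset.sum_range_sub (fun k : ℕ => Real.sin (k * x)), hN]
    simp
  exact (mul_eq_zero.mp h).resolve_left hs

lemma fejer (L : ℕ) (y : ℝ) :
    0 ≤ ∑ a ∈ Finset.range L, ∑ b ∈ Finset.range L, Real.cos (((a : ℝ) - b) * y) := by
  have : ∑ a ∈ Finset.range L, ∑ b ∈ Finset.range L, Real.cos (((a : ℝ) - b) * y) =
      (∑ a ∈ Finset.range L, Real.cos (a * y)) ^ 2 +
      (∑ a ∈ Finset.range L, Real.sin (a * y)) ^ 2 := by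
    rw [sq, sq, Finset.sum_mul_sum, Finset.sum_mul_sum, ← Finset.sum_add_distrib]
    refine Finset.sum_congr rfl fun a _ => ?_
    rw [← Finset.sum_add_distrib]
    refine Finset.sum_congr rfl fun b _ => ?_
    rw [sub_mul, Real.cos_sub]
  rw [this]
  positivity

lemma P_eval (N k : ℕ) (y : ℝ) : (P N k).eval (Real.cos y) =
    W N k / (2 * N) ^ 2 / 2 * (
      (∑ a ∈ Finset.range (2 * N), ∑ b ∈ Finset.range (2 * N),
        Real.cos (((a : ℝ) - b) * (y - k * Real.pi / N))) +
      (∑ a ∈ Finset.range (2 * N), ∑ b ∈ Finset.range (2 * N),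
        Real.cos (((a : ℝ) - b) * (y + k * Real.pi / N)))) := by
  unfold P
  rw [← Finset.sum_add_distrib, Finset.mul_sum, eval_finsetSum]
  refine Finset.sum_congr rfl fun a _ => ?_
  rw [← Finset.sum_add_distrib, Finset.mul_sum, eval_finsetSum]
  refine Finset.sum_congr rfl fun b _ => ?_
  rw [eval_mul, eval_C, Chebyshev.T_real_cos, mul_sub ((a : ℝ) - b), mul_add ((a : ℝ) - b), Real.cos_sub, Real.cos_add]
  push_cast
  ring

lemma P_nonneg (N k : ℕ) (hN : 1 ≤ N) (y : ℝ) : 0 ≤ (P N k).eval (Real.cos y) := by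
  rw [P_eval]
  have := W_pos N k hN
  exact mul_nonneg (by positivity) (add_nonneg (fejer _ _) (fejer _ _))

lemma orth (N : ℕ) (hN : 1 ≤ N) (n : ℤ) (h0 : n ≠ 0) (h1 : n < 2 * N) (h2 : -(2 * N) < n) :
    ∑ k : Fin (N + 1), W N k * Real.cos ((n : ℝ) * ((k : ℕ) * Real.pi / N)) = 0 := by
  have hN' : (N : ℝ) ≠ 0 := by positivity
  rw [W_sum N (fun k => Real.cos ((n : ℝ) * (k * Real.pi / N)))]
  have := cos_sum N (n * Real.pi / N) ?_ ?_
  · rw [← this]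
    refine Finset.sum_congr rfl fun k _ => ?_
    congr 2 <;> ring
  · intro h
    obtain ⟨j, hj⟩ := Real.sin_eq_zero_iff.mp h
    have hj2 : (n : ℝ) = 2 * N * j := by
      field_simp at hj
      have := Real.pi_pos
      linarith
    have hj3 : n = 2 * N * j := by exact_mod_cast hj2
    have hN0 : (0 : ℤ) < 2 * N := by omega
    have a1 : j < 1 := by nlinarith
    have a2 : -1 < j := by nlinarith
    have : j = 0 := by omega
    subst this
    simp at hj3
    exact h0 hj3
  · rw [show (N : ℝ) * (n * Real.pi / N) = n * Real.pi by field_simp]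
    exact Real.sin_int_mul_pi n

lemma P_sum (N : ℕ) (hN : 1 ≤ N) (t : ℝ) : ∑ k : Fin (N + 1), (P N k).eval t = 1 := by
  have hN' : (N : ℝ) ≠ 0 := by positivity
  unfold P
  simp only [eval_finsetSum, eval_mul, eval_C]
  rw [Finset.sum_comm]
  have : ∀ a ∈ Finset.range (2 * N), (∑ k : Fin (N + 1), ∑ b ∈ Finset.range (2 * N),
      W N k / (2 * (N : ℝ)) ^ 2 * Real.cos (((a : ℝ) - b) * ((k : ℕ) * Real.pi / N)) *
        (Chebyshev.T ℝ ((a : ℤ) - b)).eval t) = 1 / (2 * (N : ℝ)) := by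
    intro a ha
    rw [Finset.sum_comm, Finset.sum_eq_single_of_mem a ha]
    · have := W_sum N (fun _ => 1)
      simp at this
      simp only [sub_self, zero_mul, Real.cos_zero, mul_one, Chebyshev.T_zero, eval_one,
        ← Finset.sum_div, this]
      field_simp
      norm_num
    · intro b hb hab
      rw [Finset.mem_range] at ha hb
      have := orth N hN ((a : ℤ) - b) (by omega) (by omega) (by omega)
      push_cast at this
      rw [← Finset.sum_mul]
      simp only [div_mul_eq_mul_div, ← Finset.sum_div]
      rw [this]
      simp
  rw [Finset.sum_congr rfl this]
  simp
  field_simp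

lemma P_ge (N k : ℕ) (hN : 1 ≤ N) (hk : k ≤ N) :
    1 ≤ (P N k).eval (Real.cos (k * Real.pi / N)) := by
  have hN' : (0 : ℝ) < N := by positivity
  rw [P_eval]
  have e1 : ∑ a ∈ Finset.range (2 * N), ∑ b ∈ Finset.range (2 * N),
      Real.cos (((a : ℝ) - b) * (k * Real.pi / N - k * Real.pi / N)) = (2 * N) ^ 2 := by
    simp
    ring
  rw [e1]
  by_cases h : k = 0 ∨ k = N
  · have e2 : ∑ a ∈ Finset.range (2 * N), ∑ b ∈ Finset.range (2 * N),
        Real.cos (((a : ℝ) - b) * (k * Real.pi / N + k * Real.pi / N)) = (2 * N) ^ 2 := by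
      have : ∀ a b : ℕ, Real.cos (((a : ℝ) - b) * (k * Real.pi / N + k * Real.pi / N)) = 1 := by
        intro a b
        rcases h with rfl | rfl
        · simp
        · have := Real.cos_int_mul_two_pi ((a : ℤ) - b)
          push_cast at this
          rw [← this]
          congr 1
          field_simp
          ring
      simp [this]
      ring
    rw [e2]
    have := W_pos N k hN
    have e : W N k / (2 * N) ^ 2 / 2 * ((2 * N) ^ 2 + (2 * N) ^ 2) = W N k := by
      field_simp
      ring
    rw [e]
    exact this
  · push Not at h
    have hW : W N k = 2 := by
      unfold W
      rw [if_neg h.2, if_neg h.1]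
      norm_num
    rw [hW]
    have := fejer (2 * N) (k * Real.pi / N + k * Real.pi / N)
    calc (1 : ℝ) = 2 / (2 * N) ^ 2 / 2 * ((2 * N) ^ 2 + 0) := by field_simp; norm_num
      _ ≤ _ := by gcongr

lemma P_deg (N k : ℕ) : (P N k).natDegree ≤ 2 * N - 1 := by
  unfold P
  refine natDegree_sum_le_of_forall_le _ _ fun a ha => ?_
  refine natDegree_sum_le_of_forall_le _ _ fun b hb => ?_
  rw [Finset.mem_range] at ha hb
  refine (natDegree_C_mul_le _ _).trans ?_
  rw [Chebyshev.natDegree_T]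
  omega

end Tour

/-- polynomial tour of the simplex: for every integer `m ≥ 2` there exist
univariate real polynomials `p₁, …, p_m` of degree at most `2m - 3` that are nonnegative on
`[-1,1]`, sum to `1` on `[-1,1]`, and each attain the value `1` somewhere on `[-1,1]`. -/
theorem stmt_12 {m : ℕ} (hm : 2 ≤ m) :
    ∃ p : Fin m → Polynomial ℝ,
      (∀ i, (p i).natDegree ≤ 2 * m - 3) ∧
      (∀ i, ∀ t ∈ Set.Icc (-1 : ℝ) 1, 0 ≤ (p i).eval t) ∧
      (∀ t ∈ Set.Icc (-1 : ℝ) 1, ∑ i : Fin m, (p i).eval t = 1) ∧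
      (∀ i, ∃ t ∈ Set.Icc (-1 : ℝ) 1, (p i).eval t = 1) := by
  obtain ⟨N, rfl⟩ : ∃ N, m = N + 1 := ⟨m - 1, by omega⟩
  have hN : 1 ≤ N := by omega
  refine ⟨fun i => Tour.P N i, fun i => (Tour.P_deg N i).trans (by omega), ?_,
    fun t _ => Tour.P_sum N hN t, ?_⟩
  · intro i t ht
    rw [← Real.cos_arccos ht.1 ht.2]
    exact Tour.P_nonneg N i hN _
  · intro i
    refine ⟨Real.cos ((i : ℕ) * Real.pi / N), Real.cos_mem_Icc _, le_antisymm ?_ ?_⟩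
    · rw [← Tour.P_sum N hN (Real.cos ((i : ℕ) * Real.pi / N))]
      exact Finset.single_le_sum
        (f := fun j : Fin (N + 1) => (Tour.P N j).eval (Real.cos ((i : ℕ) * Real.pi / N)))
        (fun j _ => Tour.P_nonneg N j hN _) (Finset.mem_univ i)
    · exact Tour.P_ge N i hN (by omega)
end

section
/- Let 𝒜 = {A₁, …, A_m} be a finite set of real n×n matrices. Then limsup_{k→∞} (max_{σ ∈ {1,…,m}ᵏ} ‖A_{σ_k} ⋯ A_{σ_1}‖)^{1/k} < 1 (i.e., the joint spectral radius of 𝒜 is less than 1, where ‖·‖ is the operator norm) if and only if there exists a contracting GE-d-norm for 𝒜, i.e., a nonnegative integer d and a symmetric n×n univariate polynomial matrix P(t) of degree at most d satisfying P(t) ⪰ 0 for all t ∈ [-1,1] and ⋂_{t∈[-1,1]} Ker(P(t)) = {0}, such that the function V(x) = max_{t ∈ [-1,1]} √(xᵀP(t)x) satisfies V(A x) < V(x) for all x ≠ 0 and all A ∈ 𝒜. -/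
open Matrix Polynomial

/-- The ℓ₂→ℓ₂ operator norm of a real square matrix. -/
noncomputable def opNorm {n : ℕ} (A : Matrix (Fin n) (Fin n) ℝ) : ℝ :=
  ‖(Matrix.toEuclideanCLM (𝕜 := ℝ) A :
      EuclideanSpace ℝ (Fin n) →L[ℝ] EuclideanSpace ℝ (Fin n))‖

/-- The generalized ellipsoid norm `V(x) = max_{t ∈ [-1,1]} √(xᵀ P(t) x)`. -/
noncomputable def geNorm {n : ℕ} (P : Matrix (Fin n) (Fin n) (Polynomial ℝ))
    (x : Fin n → ℝ) : ℝ :=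
  ⨆ t : Set.Icc (-1 : ℝ) 1, Real.sqrt (x ⬝ᵥ (P.map (Polynomial.eval t.1)).mulVec x)

lemma bumps {ι : Type} [Fintype ι] (ε : ℝ) (hε : 0 < ε) :
    ∃ p : ι → ℝ[X], (∀ j, ∀ t ∈ Set.Icc (-1 : ℝ) 1, 0 ≤ (p j).eval t) ∧
      (∀ t ∈ Set.Icc (-1 : ℝ) 1, ∑ j, (p j).eval t ≤ 1 + ε) ∧
      ∀ j, ∃ t ∈ Set.Icc (-1 : ℝ) 1, 1 ≤ (p j).eval t := by
  classical
  let e := Fintype.equivFin ι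
  let τ : ι → ℝ := fun j => 1 / ((e j : ℕ) + 1 : ℝ)
  have hτ0 : ∀ j, 0 < τ j := fun j => by positivity
  have hτ1 : ∀ j, τ j ≤ 1 := fun j => by
    apply (div_le_one (by positivity)).2
    have : (0 : ℝ) ≤ (e j : ℕ) := by positivity
    linarith
  have hτi : ∀ i j, i ≠ j → τ i ≠ τ j := by
    intro i j hij h
    apply hij
    apply e.injective
    apply Fin.ext
    have h2 : ((e i : ℕ) + 1 : ℝ) = (e j : ℕ) + 1 := by
      have := congrArg (fun x : ℝ => 1 / x) h
      simpa [τ] using this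
    have h3 : ((e i : ℕ) : ℝ) = (e j : ℕ) := by linarith
    exact_mod_cast h3
  have hcard : 0 < ((Fintype.card ι : ℝ) + 1) := by positivity
  have hK : ∃ K : ℕ, ∀ i j, i ≠ j →
      (1 - (τ i - τ j) ^ 2 / 16) ^ K < ε / ((Fintype.card ι : ℝ) + 1) := by
    have : ∀ᶠ K : ℕ in Filter.atTop, ∀ i j, i ≠ j →
      (1 - (τ i - τ j) ^ 2 / 16) ^ K < ε / ((Fintype.card ι : ℝ) + 1) := by
      rw [Filter.eventually_all]
      intro i
      rw [Filter.eventually_all]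
      intro j
      by_cases hij : i = j
      · simp [hij]
      have hpos : 0 < (τ i - τ j) ^ 2 := by
        have := sub_ne_zero.2 (hτi i j hij)
        positivity
      have hle : (τ i - τ j) ^ 2 ≤ 1 := by
        have := hτ0 i; have := hτ0 j; have := hτ1 i; have := hτ1 j
        nlinarith
      have ht := tendsto_pow_atTop_nhds_zero_of_lt_one
        (r := 1 - (τ i - τ j) ^ 2 / 16) (by linarith) (by linarith)
      filter_upwards [ht.eventually_lt_const (div_pos hε hcard)] with K hK _ using hK
    exact this.exists
  obtain ⟨K, hK⟩ := hK
  have hb : ∀ j, ∀ t ∈ Set.Icc (-1 : ℝ) 1, 0 ≤ 1 - (t - τ j) ^ 2 / 4 := by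
    intro j t ht
    have := hτ0 j; have := hτ1 j
    have h1 : t - τ j ≤ 2 := by linarith [ht.2]
    have h2 : -2 ≤ t - τ j := by linarith [ht.1]
    nlinarith
  refine ⟨fun j => (1 - C (1/4) * (X - C (τ j)) ^ 2) ^ K, ?_, ?_, ?_⟩
  · intro j t ht
    have := hb j t ht
    simp only [eval_pow, eval_sub, eval_one, eval_mul, eval_C, eval_X]
    apply pow_nonneg
    linarith
  · intro t ht
    have hev : ∀ j, ((1 - C (1/4) * (X - C (τ j)) ^ 2 : ℝ[X]) ^ K).eval t
        = (1 - (t - τ j) ^ 2 / 4) ^ K := by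
      intro j
      simp only [eval_pow, eval_sub, eval_one, eval_mul, eval_C, eval_X]
      congr 1
      ring
    simp only [hev]
    rcases isEmpty_or_nonempty ι with h | h
    · simp; linarith
    obtain ⟨j0, hj0⟩ := Finite.exists_min (fun j => |t - τ j|)
    rw [← Finset.add_sum_erase _ _ (Finset.mem_univ j0)]
    apply add_le_add
    · apply pow_le_one₀ (hb j0 t ht)
      nlinarith [sq_nonneg (t - τ j0)]
    · calc ∑ j ∈ Finset.univ.erase j0, (1 - (t - τ j) ^ 2 / 4) ^ K
          ≤ ∑ j ∈ Finset.univ.erase j0, ε / ((Fintype.card ι : ℝ) + 1) := by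
            apply Finset.sum_le_sum
            intro j hj
            refine le_trans ?_ (hK j j0 (Finset.ne_of_mem_erase hj)).le
            apply pow_le_pow_left₀ (hb j t ht)
            have h1 := hj0 j
            have h2 : |τ j - τ j0| ≤ 2 * |t - τ j| := by
              have := abs_sub_le (τ j) t (τ j0)
              rw [abs_sub_comm (τ j) t] at this
              linarith
            have h3 : (τ j - τ j0) ^ 2 ≤ 4 * (t - τ j) ^ 2 := by
              rw [← sq_abs (τ j - τ j0), ← sq_abs (t - τ j)]
              nlinarith [abs_nonneg (τ j - τ j0)]
            linarith
        _ ≤ ε := by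
            rw [Finset.sum_const, nsmul_eq_mul, mul_div_assoc', div_le_iff₀ hcard, mul_comm]
            apply mul_le_mul_of_nonneg_left _ hε.le
            have : ((Finset.univ.erase j0).card : ℝ) ≤ Fintype.card ι := by
              exact_mod_cast Finset.card_le_univ _
            linarith
  · intro j
    refine ⟨τ j, ⟨by linarith [hτ0 j], hτ1 j⟩, ?_⟩
    simp

lemma quad_continuous {n : ℕ} (P : Matrix (Fin n) (Fin n) (Polynomial ℝ)) :
    Continuous (fun q : EuclideanSpace ℝ (Fin n) × Set.Icc (-1 : ℝ) 1 =>
      Real.sqrt (q.1.ofLp ⬝ᵥ (P.map (Polynomial.eval q.2.1)).mulVec q.1.ofLp)) := by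
  apply Real.continuous_sqrt.comp
  simp only [dotProduct, mulVec, Matrix.map_apply]
  fun_prop

lemma geNorm_continuous {n : ℕ} (P : Matrix (Fin n) (Fin n) (Polynomial ℝ)) :
    Continuous (fun y : EuclideanSpace ℝ (Fin n) => geNorm P y.ofLp) := by
  have h := IsCompact.continuous_sSup (K := (Set.univ : Set (Set.Icc (-1 : ℝ) 1)))
    (f := fun (y : EuclideanSpace ℝ (Fin n)) (t : Set.Icc (-1 : ℝ) 1) =>
      Real.sqrt (y.ofLp ⬝ᵥ (P.map (Polynomial.eval t.1)).mulVec y.ofLp))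
    isCompact_univ (quad_continuous P)
  simp only [Set.image_univ] at h
  exact h

lemma geNorm_bdd {n : ℕ} (P : Matrix (Fin n) (Fin n) (Polynomial ℝ)) (x : Fin n → ℝ) :
    BddAbove (Set.range fun t : Set.Icc (-1 : ℝ) 1 =>
      Real.sqrt (x ⬝ᵥ (P.map (Polynomial.eval t.1)).mulVec x)) := by
  apply IsCompact.bddAbove
  apply isCompact_range
  exact (quad_continuous P).comp (Continuous.prodMk_right (WithLp.toLp 2 x))

lemma geNorm_smul {n : ℕ} (P : Matrix (Fin n) (Fin n) (Polynomial ℝ)) (a : ℝ) (ha : 0 ≤ a)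
    (x : Fin n → ℝ) : geNorm P (a • x) = a * geNorm P x := by
  unfold geNorm
  rw [Real.mul_iSup_of_nonneg ha]
  congr 1
  ext t
  rw [mulVec_smul, smul_dotProduct, dotProduct_smul, smul_eq_mul, smul_eq_mul, ← mul_assoc,
    Real.sqrt_mul (mul_self_nonneg a), Real.sqrt_mul_self ha]

lemma opNorm_word_le {n m : ℕ} (A : Fin m → Matrix (Fin n) (Fin n) ℝ) :
    ∃ M : ℝ, 1 ≤ M ∧ ∀ w : List (Fin m), opNorm ((w.map A).prod) ≤ M ^ w.length := by
  refine ⟨1 + ∑ i, opNorm (A i), ?_, ?_⟩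
  · have : 0 ≤ ∑ i, opNorm (A i) := Finset.sum_nonneg fun i _ => norm_nonneg _
    linarith
  intro w
  induction w with
  | nil =>
    simp only [List.map_nil, List.prod_nil, List.length_nil, pow_zero, opNorm, map_one]
    exact ContinuousLinearMap.norm_id_le
  | cons i w ih =>
    simp only [List.map_cons, List.prod_cons, List.length_cons, pow_succ']
    have h1 : opNorm (A i * (w.map A).prod) ≤ opNorm (A i) * opNorm ((w.map A).prod) := by
      unfold opNorm
      rw [map_mul]
      exact norm_mul_le _ _
    refine h1.trans (mul_le_mul ?_ ih (norm_nonneg _) ?_)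
    · have := Finset.single_le_sum (f := fun i => opNorm (A i)) (fun i _ => norm_nonneg _)
        (Finset.mem_univ i)
      linarith
    · have : 0 ≤ ∑ i, opNorm (A i) := Finset.sum_nonneg fun i _ => norm_nonneg _
      linarith

lemma word_of_fn {n m k : ℕ} (A : Fin m → Matrix (Fin n) (Fin n) ℝ) (σ : Fin k → Fin m) :
    (List.ofFn fun i : Fin k => A (σ i)) = (List.ofFn σ).map A := by
  rw [List.map_ofFn]; rfl

lemma sup_root_le {n m k : ℕ} (A : Fin m → Matrix (Fin n) (Fin n) ℝ) (hk : k ≠ 0) (M : ℝ)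
    (hM : 0 ≤ M)
    (h : ∀ w : List (Fin m), w.length = k → opNorm ((w.map A).prod) ≤ M ^ k) :
    (⨆ σ : Fin k → Fin m, opNorm ((List.ofFn fun i : Fin k => A (σ i)).prod))
            ^ ((1 : ℝ) / k) ≤ M := by
  have h1 : (⨆ σ : Fin k → Fin m, opNorm ((List.ofFn fun i : Fin k => A (σ i)).prod)) ≤ M ^ k := by
    apply Real.iSup_le _ (by positivity)
    intro σ
    rw [word_of_fn]
    exact h _ (by simp)
  have h0 : 0 ≤ (⨆ σ : Fin k → Fin m, opNorm ((List.ofFn fun i : Fin k => A (σ i)).prod)) :=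
    Real.iSup_nonneg fun σ => norm_nonneg _
  calc _ ≤ (M ^ k) ^ ((1 : ℝ) / k) := Real.rpow_le_rpow h0 h1 (by positivity)
    _ = M := by rw [one_div]; exact Real.pow_rpow_inv_natCast hM hk

lemma norm_toLp_sq {n : ℕ} (x : Fin n → ℝ) : x ⬝ᵥ x = ‖WithLp.toLp 2 x‖ ^ 2 := by
  rw [EuclideanSpace.real_norm_sq_eq]
  simp [dotProduct, sq]

lemma forward_s17 {n m N : ℕ} (A : Fin m → Matrix (Fin n) (Fin n) ℝ) (hN : N ≠ 0) (c : ℝ)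
    (hc : 0 < c) (hc1 : c < 1)
    (h : ∀ w : List (Fin m), w.length = N → opNorm ((w.map A).prod) ≤ c ^ N) :
    ∃ (d : ℕ) (P : Matrix (Fin n) (Fin n) (Polynomial ℝ)),
      P.IsSymm ∧
      (∀ i j, (P i j).natDegree ≤ d) ∧
      (∀ t ∈ Set.Icc (-1 : ℝ) 1, (P.map (Polynomial.eval t)).PosSemidef) ∧
      (∀ x : Fin n → ℝ,
        (∀ t ∈ Set.Icc (-1 : ℝ) 1, (P.map (Polynomial.eval t)).mulVec x = 0) → x = 0) ∧
      (∀ x : Fin n → ℝ, x ≠ 0 → ∀ i : Fin m,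
        geNorm P ((A i).mulVec x) < geNorm P x) := by
  classical
  let ι := {w : List (Fin m) // w.length < N}
  haveI : Fintype ι := (List.finite_length_lt (Fin m) N).fintype
  let B : ι → Matrix (Fin n) (Fin n) ℝ := fun w => (c⁻¹ ^ w.1.length) • (w.1.map A).prod
  obtain ⟨p, hp0, hps, hp1⟩ := bumps (ι := ι) (1 / c - 1)
    (by have := one_lt_one_div hc hc1; linarith)
  let P : Matrix (Fin n) (Fin n) (Polynomial ℝ) :=
    fun i j => ∑ s, C (((B s)ᵀ * B s) i j) * p s
  have hPt : ∀ t, P.map (Polynomial.eval t) = ∑ s, (p s).eval t • ((B s)ᵀ * B s) := by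
    intro t
    ext i j
    have h1 : (P.map (Polynomial.eval t)) i j
        = (∑ s, C (((B s)ᵀ * B s) i j) * p s).eval t := rfl
    rw [h1, eval_finsetSum, Matrix.sum_apply]
    refine Finset.sum_congr rfl fun s _ => ?_
    rw [eval_mul, eval_C, Matrix.smul_apply, smul_eq_mul, mul_comm]
  let q : ι → (Fin n → ℝ) → ℝ := fun s x => ‖WithLp.toLp 2 ((B s).mulVec x)‖
  have hq : ∀ t x, x ⬝ᵥ (P.map (Polynomial.eval t)).mulVec x
      = ∑ s, (p s).eval t * q s x ^ 2 := by
    intro t x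
    rw [hPt, Matrix.sum_mulVec, dotProduct_sum]
    refine Finset.sum_congr rfl fun s _ => ?_
    rw [Matrix.smul_mulVec, dotProduct_smul, smul_eq_mul, ← Matrix.mulVec_mulVec,
      Matrix.dotProduct_mulVec, Matrix.vecMul_transpose, norm_toLp_sq]
  have hlow1 : ∀ s, ∃ t ∈ Set.Icc (-1 : ℝ) 1, ∀ x,
      q s x ^ 2 ≤ x ⬝ᵥ (P.map (Polynomial.eval t)).mulVec x := by
    intro s
    obtain ⟨t, ht, h1⟩ := hp1 s
    refine ⟨t, ht, fun x => ?_⟩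
    rw [hq]
    refine le_trans ?_ (Finset.single_le_sum (f := fun s => (p s).eval t * q s x ^ 2)
      (fun s _ => mul_nonneg (hp0 s t ht) (sq_nonneg _)) (Finset.mem_univ s))
    exact le_mul_of_one_le_left (sq_nonneg _) h1
  have hlow : ∀ s x, q s x ≤ geNorm P x := by
    intro s x
    obtain ⟨t, ht, h1⟩ := hlow1 s
    refine le_trans ?_ (le_ciSup (geNorm_bdd P x) ⟨t, ht⟩)
    exact Real.le_sqrt_of_sq_le (h1 x)
  have hup : ∀ x M, 0 ≤ M → (∀ s, q s x ≤ M) → geNorm P x ≤ Real.sqrt (1 / c) * M := by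
    intro x M hM hs
    refine Real.iSup_le (fun t => ?_) (by positivity)
    rw [hq]
    apply Real.sqrt_le_iff.2 ⟨by positivity, ?_⟩
    rw [mul_pow, Real.sq_sqrt (by positivity)]
    calc ∑ s, (p s).eval t.1 * q s x ^ 2 ≤ ∑ s, (p s).eval t.1 * M ^ 2 := by
          refine Finset.sum_le_sum fun s _ => mul_le_mul_of_nonneg_left ?_ (hp0 s _ t.2)
          exact pow_le_pow_left₀ (norm_nonneg _) (hs s) 2
      _ = (∑ s, (p s).eval t.1) * M ^ 2 := by rw [Finset.sum_mul]
      _ ≤ 1 / c * M ^ 2 := by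
          refine mul_le_mul_of_nonneg_right ?_ (sq_nonneg _)
          linarith [hps t.1 t.2]
  let s0 : ι := ⟨[], by simpa using Nat.pos_of_ne_zero hN⟩
  have hs0 : ∀ x, q s0 x = ‖WithLp.toLp 2 x‖ := by
    intro x; simp [q, B, s0]
  refine ⟨Finset.univ.sup fun i => Finset.univ.sup fun j => (P i j).natDegree, P, ?_, ?_, ?_, ?_, ?_⟩
  · ext1 i j
    simp only [P, Matrix.transpose_apply]
    refine Finset.sum_congr rfl fun s _ => ?_
    congr 2
    simp [Matrix.mul_apply, mul_comm]
  · intro i j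
    exact le_trans (Finset.le_sup (f := fun j => (P i j).natDegree) (Finset.mem_univ j))
      (Finset.le_sup (f := fun i => Finset.univ.sup fun j => (P i j).natDegree) (Finset.mem_univ i))
  · intro t ht
    rw [hPt]
    refine Matrix.posSemidef_sum _ fun s _ => ?_
    refine Matrix.PosSemidef.smul ?_ (hp0 s t ht)
    simpa using Matrix.posSemidef_conjTranspose_mul_self (B s)
  · intro x hx
    obtain ⟨t, ht, h1⟩ := hlow1 s0
    have h2 := h1 x
    rw [hx t ht, hs0, dotProduct_zero, ← norm_toLp_sq] at h2
    exact dotProduct_self_eq_zero.1 (le_antisymm h2 (by rw [norm_toLp_sq]; positivity))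
  · intro x hx i
    have hpos : 0 < geNorm P x := by
      refine lt_of_lt_of_le ?_ (hlow s0 x)
      rw [hs0]
      exact norm_pos_iff.2 (by simpa using hx)
    have hstep : ∀ s, q s ((A i).mulVec x) ≤ c * geNorm P x := by
      rintro ⟨w, hw⟩
      have hqe : q ⟨w, hw⟩ ((A i).mulVec x)
          = c⁻¹ ^ w.length * ‖WithLp.toLp 2 ((((w ++ [i]).map A).prod).mulVec x)‖ := by
        simp only [q, B, Matrix.smul_mulVec, Matrix.mulVec_mulVec, WithLp.toLp_smul, norm_smul]
        rw [Real.norm_of_nonneg (by positivity)]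
        simp
      rw [hqe]
      by_cases hlt : w.length + 1 < N
      · have h1 := hlow ⟨w ++ [i], by simpa using hlt⟩ x
        have hqe2 : q ⟨w ++ [i], by simpa using hlt⟩ x
            = c⁻¹ ^ (w.length + 1) * ‖WithLp.toLp 2 ((((w ++ [i]).map A).prod).mulVec x)‖ := by
          simp only [q, B, Matrix.smul_mulVec, WithLp.toLp_smul, norm_smul]
          rw [Real.norm_of_nonneg (by positivity)]
          simp
        rw [hqe2] at h1
        have h2 := mul_le_mul_of_nonneg_left h1 hc.le
        refine le_trans (le_of_eq ?_) h2
        rw [pow_succ']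
        field_simp
      · have hN' : w.length + 1 = N := by omega
        have h1 := h (w ++ [i]) (by simpa using hN')
        have h2 : ‖WithLp.toLp 2 ((((w ++ [i]).map A).prod).mulVec x)‖
            ≤ c ^ N * ‖WithLp.toLp 2 x‖ := by
          rw [← Matrix.toEuclideanCLM_toLp]
          exact ContinuousLinearMap.le_of_opNorm_le _ h1 _
        have h3 := hlow s0 x
        rw [hs0] at h3
        calc _ ≤ c⁻¹ ^ w.length * (c ^ N * ‖WithLp.toLp 2 x‖) :=
              mul_le_mul_of_nonneg_left h2 (by positivity)
          _ = c * ‖WithLp.toLp 2 x‖ := by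
              rw [← hN', pow_succ, inv_pow]
              field_simp
          _ ≤ _ := mul_le_mul_of_nonneg_left h3 hc.le
    have h1 := hup _ _ (by positivity) hstep
    refine lt_of_le_of_lt h1 ?_
    rw [← mul_assoc]
    apply mul_lt_of_lt_one_left hpos
    have : Real.sqrt (1 / c) * c = Real.sqrt c := by
      rw [one_div, Real.sqrt_inv]
      have h5 : 0 < Real.sqrt c := Real.sqrt_pos.2 hc
      field_simp
      rw [Real.sq_sqrt hc.le]
    rw [this]
    exact (Real.sqrt_lt' one_pos).2 (by simpa using hc1)

lemma compact_lt_one {X : Type*} [TopologicalSpace X] {K : Set X} (hK : IsCompact K)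
    (f : X → ℝ) (hf : ContinuousOn f K) (h : ∀ x ∈ K, f x < 1) :
    ∃ γ : ℝ, 0 < γ ∧ γ < 1 ∧ ∀ x ∈ K, f x ≤ γ := by
  rcases K.eq_empty_or_nonempty with rfl | hne
  · exact ⟨1 / 2, by norm_num, by norm_num, by simp⟩
  obtain ⟨x, hx, hm⟩ := hK.exists_isMaxOn hne hf
  exact ⟨max (f x) (1 / 2), by simp, max_lt (h x hx) (by norm_num),
    fun y hy => le_trans (hm hy) (le_max_left _ _)⟩

lemma backward {n m : ℕ} (A : Fin m → Matrix (Fin n) (Fin n) ℝ)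
    (P : Matrix (Fin n) (Fin n) (Polynomial ℝ))
    (hP : ∀ t ∈ Set.Icc (-1 : ℝ) 1, (P.map (Polynomial.eval t)).PosSemidef)
    (hker : ∀ x : Fin n → ℝ,
        (∀ t ∈ Set.Icc (-1 : ℝ) 1, (P.map (Polynomial.eval t)).mulVec x = 0) → x = 0)
    (hcon : ∀ x : Fin n → ℝ, x ≠ 0 → ∀ i : Fin m,
        geNorm P ((A i).mulVec x) < geNorm P x) :
    ∃ γ C : ℝ, 0 < γ ∧ γ < 1 ∧ 0 < C ∧
      ∀ w : List (Fin m), opNorm ((w.map A).prod) ≤ C * γ ^ w.length := by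
  let U : EuclideanSpace ℝ (Fin n) → ℝ := fun y => geNorm P y.ofLp
  have hU : Continuous U := geNorm_continuous P
  have hsm : ∀ (a : ℝ) y, 0 ≤ a → U (a • y) = a * U y := fun a y ha => geNorm_smul P a ha _
  have hpos : ∀ x : Fin n → ℝ, x ≠ 0 → 0 < geNorm P x := by
    intro x hx
    have : ∃ t, ∃ ht : t ∈ Set.Icc (-1 : ℝ) 1, (P.map (Polynomial.eval t)).mulVec x ≠ 0 := by
      by_contra hcon
      push Not at hcon
      exact hx (hker x hcon)
    obtain ⟨t, ht, hne⟩ := this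
    refine lt_of_lt_of_le ?_ (le_ciSup (geNorm_bdd P x) ⟨t, ht⟩)
    apply Real.sqrt_pos.2
    have h0 := (hP t ht).dotProduct_mulVec_nonneg x
    have h1 := (hP t ht).dotProduct_mulVec_zero_iff x
    rw [star_trivial] at h0 h1
    exact lt_of_le_of_ne h0 (fun h => hne (h1.1 h.symm))
  let S := Metric.sphere (0 : EuclideanSpace ℝ (Fin n)) 1
  have hS : IsCompact S := isCompact_sphere _ _
  have hSne : ∀ y ∈ S, y.ofLp ≠ 0 := by
    intro y hy h0
    have : y = 0 := by ext i; simp [h0]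
    rw [mem_sphere_zero_iff_norm, this, norm_zero] at hy
    exact zero_ne_one hy
  have hSpos : ∀ y ∈ S, 0 < U y := fun y hy => hpos _ (hSne y hy)
  let T : Fin m → EuclideanSpace ℝ (Fin n) →L[ℝ] EuclideanSpace ℝ (Fin n) :=
    fun i => Matrix.toEuclideanCLM (𝕜 := ℝ) (A i)
  -- normalisation
  have hnorm : ∀ y : EuclideanSpace ℝ (Fin n), y ≠ 0 →
      ∃ z ∈ S, y = ‖y‖ • z := by
    intro y hy
    have hy' : ‖y‖ ≠ 0 := norm_ne_zero_iff.2 hy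
    refine ⟨‖y‖⁻¹ • y, ?_, ?_⟩
    · rw [mem_sphere_zero_iff_norm, norm_smul, norm_inv, norm_norm, inv_mul_cancel₀ hy']
    · rw [smul_smul, mul_inv_cancel₀ hy', one_smul]
  have hU0 : U 0 = 0 := by simpa using hsm 0 0 le_rfl
  have hγi : ∀ i, ∃ γ : ℝ, 0 < γ ∧ γ < 1 ∧ ∀ y ∈ S, U (T i y) / U y ≤ γ := by
    intro i
    apply compact_lt_one hS
    · apply ContinuousOn.div
      · exact (hU.comp (T i).continuous).continuousOn
      · exact hU.continuousOn
      · exact fun y hy => (hSpos y hy).ne'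
    · intro y hy
      rw [div_lt_one (hSpos y hy)]
      exact hcon _ (hSne y hy) i
  choose g hg0 hg1 hg using hγi
  obtain ⟨γ, hγ0, hγ1, hγ⟩ : ∃ γ : ℝ, 0 < γ ∧ γ < 1 ∧ ∀ i, g i ≤ γ := by
    obtain ⟨γ, h1, h2, h3⟩ := compact_lt_one (K := (Set.univ : Set (Fin m))) isCompact_univ g
      continuous_of_discreteTopology.continuousOn (fun i _ => hg1 i)
    exact ⟨γ, h1, h2, fun i => h3 i trivial⟩
  have hstep : ∀ i y, U (T i y) ≤ γ * U y := by
    intro i y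
    by_cases hy : y = 0
    · simp [hy, hU0]
    obtain ⟨z, hz, hyz⟩ := hnorm y hy
    rw [hyz, map_smul, hsm _ _ (norm_nonneg _), hsm _ _ (norm_nonneg _)]
    have h1 := (div_le_iff₀ (hSpos z hz)).1 ((hg i z hz).trans (hγ i))
    calc _ ≤ ‖y‖ * (γ * U z) := mul_le_mul_of_nonneg_left h1 (norm_nonneg _)
      _ = _ := by ring
  have hword : ∀ (w : List (Fin m)) y,
      U (Matrix.toEuclideanCLM (𝕜 := ℝ) ((w.map A).prod) y) ≤ γ ^ w.length * U y := by
    intro w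
    induction w with
    | nil => intro y; simp
    | cons i w ih =>
      intro y
      rw [List.map_cons, List.prod_cons, map_mul, List.length_cons, pow_succ', mul_assoc]
      exact (hstep i _).trans (mul_le_mul_of_nonneg_left (ih y) hγ0.le)
  obtain ⟨a, ha, haU⟩ : ∃ a : ℝ, 0 < a ∧ ∀ y ∈ S, a ≤ U y :=
    hS.exists_forall_le' hU.continuousOn hSpos
  obtain ⟨b, hb⟩ := hS.bddAbove_image hU.continuousOn
  have hlow : ∀ y, a * ‖y‖ ≤ U y := by
    intro y
    by_cases hy : y = 0
    · simp [hy, hU0]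
    obtain ⟨z, hz, hyz⟩ := hnorm y hy
    have : U y = ‖y‖ * U z := by
      conv_lhs => rw [hyz]
      exact hsm _ _ (norm_nonneg _)
    rw [this, mul_comm]
    exact mul_le_mul_of_nonneg_left (haU z hz) (norm_nonneg _)
  have hupp : ∀ y, U y ≤ max b 1 * ‖y‖ := by
    intro y
    by_cases hy : y = 0
    · simp [hy, hU0]
    obtain ⟨z, hz, hyz⟩ := hnorm y hy
    have : U y = ‖y‖ * U z := by
      conv_lhs => rw [hyz]
      exact hsm _ _ (norm_nonneg _)
    rw [this, mul_comm]
    exact mul_le_mul_of_nonneg_right ((hb ⟨z, hz, rfl⟩).trans (le_max_left _ _)) (norm_nonneg _)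
  have hb1 : 0 < max b 1 := by simp
  refine ⟨γ, max b 1 / a, hγ0, hγ1, by positivity, fun w => ?_⟩
  apply ContinuousLinearMap.opNorm_le_bound _ (by positivity)
  intro y
  have h1 := (hlow _).trans ((hword w y).trans
    (mul_le_mul_of_nonneg_left (hupp y) (by positivity)))
  have h2 := (le_div_iff₀' ha).2 h1
  refine h2.trans (le_of_eq ?_)
  ring

/-- the joint spectral radius of `𝒜 = {A₁, …, A_m}` is less than `1` if and
only if there exists a contracting GE-`d`-norm for `𝒜`. -/
theorem stmt_17 {n m : ℕ} (A : Fin m → Matrix (Fin n) (Fin n) ℝ) :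
    Filter.limsup
        (fun k : ℕ =>
          (⨆ σ : Fin k → Fin m, opNorm ((List.ofFn fun i : Fin k => A (σ i)).prod))
            ^ ((1 : ℝ) / k))
        Filter.atTop < 1 ↔
    ∃ (d : ℕ) (P : Matrix (Fin n) (Fin n) (Polynomial ℝ)),
      P.IsSymm ∧
      (∀ i j, (P i j).natDegree ≤ d) ∧
      (∀ t ∈ Set.Icc (-1 : ℝ) 1, (P.map (Polynomial.eval t)).PosSemidef) ∧
      (∀ x : Fin n → ℝ,
        (∀ t ∈ Set.Icc (-1 : ℝ) 1, (P.map (Polynomial.eval t)).mulVec x = 0) → x = 0) ∧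
      (∀ x : Fin n → ℝ, x ≠ 0 → ∀ i : Fin m,
        geNorm P ((A i).mulVec x) < geNorm P x) := by
  
  have hu0 : ∀ k : ℕ, 0 ≤ (⨆ σ : Fin k → Fin m,
      opNorm ((List.ofFn fun i : Fin k => A (σ i)).prod)) ^ ((1 : ℝ) / k) := fun k =>
    Real.rpow_nonneg (Real.iSup_nonneg fun σ => norm_nonneg _) _
  constructor
  · intro hlim
    obtain ⟨c, hc, hc1⟩ := exists_between (max_lt hlim (zero_lt_one' ℝ))
    have hc0 : 0 < c := lt_of_le_of_lt (le_max_right _ _) hc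
    have hlc := lt_of_le_of_lt (le_max_left _ _) hc
    obtain ⟨M, hM1, hM⟩ := opNorm_word_le A
    have hev := Filter.eventually_lt_of_limsup_lt hlc (by
      refine Filter.isBoundedUnder_of_eventually_le (a := M) ?_
      filter_upwards [Filter.eventually_ne_atTop 0] with k hk
      exact sup_root_le A hk M (by linarith) (fun w hw => by rw [← hw]; exact hM w))
    obtain ⟨N, hN, hN0⟩ := (hev.and (Filter.eventually_ne_atTop 0)).exists
    refine forward_s17 A hN0 c hc0 hc1 ?_
    intro w hw
    subst hw
    have hs0 : 0 ≤ ⨆ σ : Fin w.length → Fin m,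
      opNorm ((List.ofFn fun i : Fin w.length => A (σ i)).prod) :=
      Real.iSup_nonneg fun σ => norm_nonneg _
    have h1 : (⨆ σ : Fin w.length → Fin m,
      opNorm ((List.ofFn fun i : Fin w.length => A (σ i)).prod)) ≤ c ^ w.length := by
      have h2 := pow_le_pow_left₀ (hu0 _) hN.le w.length
      rw [one_div, Real.rpow_inv_natCast_pow hs0 hN0] at h2
      exact h2
    refine le_trans ?_ h1
    have h3 := le_ciSup (f := fun σ : Fin w.length → Fin m =>
      opNorm ((List.ofFn fun i : Fin w.length => A (σ i)).prod))
      (Set.finite_range _).bddAbove w.get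
    simp only [word_of_fn, List.ofFn_get] at h3
    simpa only [word_of_fn] using h3
  · rintro ⟨d, P, -, -, hP, hker, hcon⟩
    obtain ⟨γ, C, hγ0, hγ1, hC, hw⟩ := backward A P hP hker hcon
    obtain ⟨δ, hδ, hδ1⟩ := exists_between hγ1
    have hδ0 : 0 < δ := hγ0.trans hδ
    refine lt_of_le_of_lt (Filter.limsup_le_of_le ?_ ?_) hδ1
    · exact (Filter.isBoundedUnder_of ⟨0, hu0⟩).isCoboundedUnder_flip
    have ht := tendsto_pow_atTop_nhds_zero_of_lt_one (r := γ / δ) (by positivity)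
      ((div_lt_one hδ0).2 hδ)
    filter_upwards [Filter.eventually_ne_atTop 0, ht.eventually_lt_const (inv_pos.2 hC)]
      with k hk hlt
    refine sup_root_le A hk δ hδ0.le fun w hwk => (hw w).trans ?_
    rw [hwk]
    rw [div_pow, div_lt_iff₀ (by positivity)] at hlt
    have := mul_le_mul_of_nonneg_left hlt.le hC.le
    rwa [← mul_assoc, mul_inv_cancel₀ hC.ne', one_mul] at this
end
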